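/- arXiv:1402.3006 — 2 statements merged into one kernel-verified Lean document; each statement's English description precedes it below -/
import Mathlib

section
/- Let a : [-1,1] × [0,∞) → [0,∞) be continuous and F ∈ 𝔉, and let B ⊆ A be two sets of nonnegative functions in W¹₁(-1,1). Assume that I(a,w*) ≤ I(a,w) for every w ∈ B, and that for every u ∈ A there exists a sequence u_k ∈ B such that u_k → u in W¹₁(-1,1) and I(a,u_k) → I(a,u). Then I(a,u*) ≤ I(a,u) for every u ∈ A. -/
open MeasureTheory Set Filter
open scoped ENNReal BigOperators NNReal

noncomputable section

/-- `u ∈ W¹₁(-1,1)`: `u` is absolutely continuous on `[-1,1]` with (a.e.) derivative in `L¹`,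
encoded via the fundamental theorem of calculus with the pointwise derivative `deriv u`. -/
def MemW11 (u : ℝ → ℝ) : Prop :=
  IntegrableOn (deriv u) (Icc (-1 : ℝ) 1) volume ∧
  ∀ x ∈ Icc (-1 : ℝ) 1, u x = u (-1) + ∫ t in (-1 : ℝ)..x, deriv u t

/-- Convergence `u_k → u` in `W¹₁(-1,1)`. -/
def W11Tendsto (uk : ℕ → ℝ → ℝ) (u : ℝ → ℝ) : Prop :=
  Tendsto (fun k => ∫ x in Icc (-1 : ℝ) 1, (|uk k x - u x| + |deriv (uk k) x - deriv u x|))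
    atTop (nhds 0)

/-- `F ∈ 𝔉`: continuous, nonnegative, convex and nondecreasing in the second argument. -/
def MemFrakF (F : ℝ → ℝ → ℝ) : Prop :=
  ContinuousOn (fun p : ℝ × ℝ => F p.1 p.2) (Ici (0 : ℝ) ×ˢ Ici (0 : ℝ)) ∧
  (∀ v p : ℝ, 0 ≤ v → 0 ≤ p → 0 ≤ F v p) ∧
  (∀ v : ℝ, 0 ≤ v → ConvexOn ℝ (Ici (0 : ℝ)) (F v)) ∧
  (∀ v : ℝ, 0 ≤ v → MonotoneOn (F v) (Ici (0 : ℝ)))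

/-- A continuous nonnegative weight on `[-1,1] × [0,∞)`. -/
def Weight (a : ℝ → ℝ → ℝ) : Prop :=
  ContinuousOn (fun p : ℝ × ℝ => a p.1 p.2) (Icc (-1 : ℝ) 1 ×ˢ Ici (0 : ℝ)) ∧
  ∀ x v : ℝ, x ∈ Icc (-1 : ℝ) 1 → 0 ≤ v → 0 ≤ a x v

/-- Condition (C): `a(s,v) + a(t,v) ≥ a(1 - t + s, v)` for `-1 ≤ s ≤ t ≤ 1`, `v ≥ 0`. -/
def CondC (a : ℝ → ℝ → ℝ) : Prop :=
  ∀ s t v : ℝ, -1 ≤ s → s ≤ t → t ≤ 1 → 0 ≤ v → a (1 - t + s) v ≤ a s v + a t v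

/-- Condition (C) for a one-variable weight. -/
def CondC1 (a : ℝ → ℝ) : Prop :=
  ∀ s t : ℝ, -1 ≤ s → s ≤ t → t ≤ 1 → a (1 - t + s) ≤ a s + a t

/-- Condition (C'): `a(s,v) + a(t,v) ≥ a((s-t)/2, v) + a((t-s)/2, v)`. -/
def CondC' (a : ℝ → ℝ → ℝ) : Prop :=
  ∀ s t v : ℝ, s ∈ Icc (-1 : ℝ) 1 → t ∈ Icc (-1 : ℝ) 1 → 0 ≤ v →
    a ((s - t) / 2) v + a ((t - s) / 2) v ≤ a s v + a t v

/-- The functional `I(a,u) = ∫_{-1}^1 F(u(x), a(x,u(x))·|u'(x)|) dx ∈ [0,∞]`. -/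
def Ifun (F a : ℝ → ℝ → ℝ) (u : ℝ → ℝ) : ℝ≥0∞ :=
  ∫⁻ x in Icc (-1 : ℝ) 1, ENNReal.ofReal (F (u x) (a x (u x) * |deriv u x|))

/-- The monotone rearrangement `u*(x) = ∫₀^∞ χ_{[1-|A_t|,1]}(x) dt`,
where `A_t = {y ∈ [-1,1] : u(y) > t}`. -/
def mrear (u : ℝ → ℝ) (x : ℝ) : ℝ :=
  ∫ t in Ioi (0 : ℝ),
    (Icc (1 - (volume {y ∈ Icc (-1 : ℝ) 1 | u y > t}).toReal) 1).indicator
      (fun _ => (1 : ℝ)) x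

/-- The symmetric rearrangement `ū(x) = ∫₀^∞ χ_{[-|A_t|/2, |A_t|/2]}(x) dt`. -/
def srear (u : ℝ → ℝ) (x : ℝ) : ℝ :=
  ∫ t in Ioi (0 : ℝ),
    (Icc (-((volume {y ∈ Icc (-1 : ℝ) 1 | u y > t}).toReal / 2))
        ((volume {y ∈ Icc (-1 : ℝ) 1 | u y > t}).toReal / 2)).indicator
      (fun _ => (1 : ℝ)) x

/-- `u` is piecewise linear on `[-1,1]`: there is a partition `-1 = x₀ < ⋯ < x_n = 1`
such that `u` is affine on each `[x_i, x_{i+1}]`. -/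
def PiecewiseLinear (u : ℝ → ℝ) : Prop :=
  ∃ n : ℕ, ∃ x : Fin (n + 1) → ℝ, x 0 = -1 ∧ x (Fin.last n) = 1 ∧ StrictMono x ∧
    ∀ i : Fin n, ∃ c d : ℝ, ∀ y ∈ Icc (x i.castSucc) (x i.succ), u y = c * y + d

/-! ### Monotone rearrangement -/

/-- The distribution function of `u` on `[-1,1]`. -/
def distribFun (u : ℝ → ℝ) (t : ℝ) : ℝ :=
  volume.real {y ∈ Icc (-1 : ℝ) 1 | u y > t}

lemma superlevel_ne_top (u : ℝ → ℝ) (t : ℝ) : volume {y ∈ Icc (-1 : ℝ) 1 | u y > t} ≠ ∞ :=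
  measure_ne_top_of_subset (fun _ hy => hy.1) (by simp : volume (Icc (-1 : ℝ) 1) ≠ ∞)

lemma distribFun_mono {u v : ℝ → ℝ} {s t : ℝ}
    (h : ∀ y ∈ Icc (-1 : ℝ) 1, t < u y → s < v y) : distribFun u t ≤ distribFun v s :=
  measureReal_mono (fun y hy => ⟨hy.1, h y hy.1 hy.2⟩) (superlevel_ne_top v s)

lemma distribFun_antitone (u : ℝ → ℝ) : Antitone (distribFun u) :=
  fun _ _ hst => distribFun_mono fun _ _ h => hst.trans_lt h

lemma mrear_eq_measureReal (u : ℝ → ℝ) {x : ℝ} (hx : x ≤ 1) :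
    mrear u x = volume.real {t | 0 < t ∧ 1 - x ≤ distribFun u t} := by
  have hm : MeasurableSet {t | 1 - x ≤ distribFun u t} :=
    measurableSet_le measurable_const (distribFun_antitone u).measurable
  have : mrear u x = ∫ t in Ioi (0 : ℝ),
      {t | 1 - x ≤ distribFun u t}.indicator (fun _ => (1 : ℝ)) t := by
    refine integral_congr_ae (Eventually.of_forall fun t => ?_)
    change (Icc (1 - distribFun u t) 1).indicator (fun _ => (1 : ℝ)) x = _
    by_cases h : 1 - x ≤ distribFun u t
    · rw [indicator_of_mem (show x ∈ Icc _ _ from ⟨by linarith, hx⟩),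
        indicator_of_mem (show t ∈ {t | 1 - x ≤ distribFun u t} from h)]
    · rw [indicator_of_notMem (show x ∉ Icc _ _ from fun h' => h (by linarith [h'.1])),
        indicator_of_notMem (show t ∉ {t | 1 - x ≤ distribFun u t} from h)]
  rw [this, integral_indicator hm, setIntegral_const, smul_eq_mul, mul_one,
    measureReal_restrict_apply hm, inter_comm]
  rfl

lemma mrear_nonneg (u : ℝ → ℝ) (x : ℝ) : 0 ≤ mrear u x :=
  integral_nonneg fun _ => indicator_nonneg (fun _ _ => zero_le_one) _

lemma mrear_le {u : ℝ → ℝ} {x t : ℝ} (hx : x ≤ 1) (ht : 0 ≤ t) (h : distribFun u t < 1 - x) :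
    mrear u x ≤ t := by
  rw [mrear_eq_measureReal u hx]
  have hsub : {s | 0 < s ∧ 1 - x ≤ distribFun u s} ⊆ Ioc 0 t := by
    rintro s ⟨hs0, hs⟩
    refine ⟨hs0, ?_⟩
    by_contra! hst
    linarith [distribFun_antitone u hst.le]
  refine (measureReal_mono hsub (by simp)).trans ?_
  simp [ht]

lemma distribFun_eq_zero {u : ℝ → ℝ} {t : ℝ} (h : ∀ y ∈ Icc (-1 : ℝ) 1, u y ≤ t) :
    distribFun u t = 0 := by
  have : {y ∈ Icc (-1 : ℝ) 1 | u y > t} = ∅ :=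
    eq_empty_of_forall_notMem fun y hy => (h y hy.1).not_gt hy.2
  rw [distribFun, this, measureReal_empty]

lemma le_mrear {u : ℝ → ℝ} (hb : BddAbove (u '' Icc (-1) 1)) {x t : ℝ} (hx : x < 1)
    (h : 1 - x ≤ distribFun u t) : t ≤ mrear u x := by
  rcases le_or_gt t 0 with ht | ht
  · exact ht.trans (mrear_nonneg u x)
  obtain ⟨M, hM⟩ := hb
  rw [mrear_eq_measureReal u hx.le]
  have hsub : Ioc 0 t ⊆ {s | 0 < s ∧ 1 - x ≤ distribFun u s} := fun s hs =>
    ⟨hs.1, h.trans (distribFun_antitone u hs.2)⟩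
  have hfin : volume {s | 0 < s ∧ 1 - x ≤ distribFun u s} ≠ ∞ := by
    refine measure_ne_top_of_subset ?_ (measure_Ioc_lt_top (a := (0 : ℝ)) (b := M)).ne
    rintro s ⟨hs0, hs⟩
    refine ⟨hs0, ?_⟩
    by_contra! hsM
    have := distribFun_eq_zero (u := u) (t := s)
      fun y hy => (hM (mem_image_of_mem u hy)).trans hsM.le
    linarith
  refine le_trans ?_ (measureReal_mono hsub hfin)
  simp [ht.le]

lemma distribFun_lt {u : ℝ → ℝ} (hb : BddAbove (u '' Icc (-1) 1)) {x t : ℝ} (hx : x < 1)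
    (h : mrear u x < t) : distribFun u t < 1 - x := by
  by_contra! h'
  exact (le_mrear hb hx h').not_gt h

lemma le_distribFun {u : ℝ → ℝ} {x t : ℝ} (hx : x ≤ 1) (ht : 0 ≤ t) (h : t < mrear u x) :
    1 - x ≤ distribFun u t := by
  by_contra! h'
  exact (mrear_le hx ht h').not_gt h

lemma mrear_monotoneOn {u : ℝ → ℝ} (hb : BddAbove (u '' Icc (-1) 1)) :
    MonotoneOn (mrear u) (Ioo (-1) 1) := by
  intro x hx y hy hxy
  refine le_of_forall_lt fun t ht => ?_
  rcases lt_or_ge t 0 with h0 | h0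
  · exact h0.trans_le (mrear_nonneg u y)
  obtain ⟨s, hts, hs⟩ := exists_between ht
  refine hts.trans_le (le_mrear hb hy.2 ?_)
  linarith [le_distribFun hx.2.le (h0.trans hts.le) hs]

/-- The monotone rearrangement is nonexpansive for the supremum norm. -/
lemma mrear_le_add {u v : ℝ → ℝ} (hb : BddAbove (u '' Icc (-1) 1)) {ε x : ℝ}
    (hε : 0 ≤ ε) (hx : x < 1) (h : ∀ y ∈ Icc (-1 : ℝ) 1, v y ≤ u y + ε) :
    mrear v x ≤ mrear u x + ε := by
  refine le_of_forall_gt_imp_ge_of_dense fun t ht => ?_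
  refine mrear_le hx.le (by linarith [mrear_nonneg u x]) ?_
  refine lt_of_le_of_lt ?_ (distribFun_lt hb hx (show mrear u x < t - ε by linarith))
  exact distribFun_mono fun y hy hty => by linarith [h y hy]

lemma tendsto_mrear {u : ℝ → ℝ} {uk : ℕ → ℝ → ℝ} (hb : BddAbove (u '' Icc (-1) 1))
    (hbk : ∀ k, BddAbove (uk k '' Icc (-1) 1))
    (h : TendstoUniformlyOn uk u atTop (Icc (-1) 1)) {x : ℝ} (hx : x < 1) :
    Tendsto (fun k => mrear (uk k) x) atTop (nhds (mrear u x)) := by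
  rw [Metric.tendsto_nhds]
  intro ε hε
  filter_upwards [Metric.tendstoUniformlyOn_iff.1 h (ε / 2) (half_pos hε)] with k hk
  have hk' : ∀ y ∈ Icc (-1 : ℝ) 1, |u y - uk k y| < ε / 2 := hk
  have h1 := mrear_le_add (v := uk k) hb (half_pos hε).le hx fun y hy => by
    linarith [(abs_lt.1 (hk' y hy)).1]
  have h2 := mrear_le_add (v := u) (hbk k) (half_pos hε).le hx fun y hy => by
    linarith [(abs_lt.1 (hk' y hy)).2]
  rw [Real.dist_eq, abs_lt]
  constructor <;> linarith

/-! ### Functions in `W¹₁` -/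

lemma MemW11.intervalIntegrable {u : ℝ → ℝ} (hu : MemW11 u) {c d : ℝ}
    (hc : c ∈ Icc (-1 : ℝ) 1) (hd : d ∈ Icc (-1 : ℝ) 1) :
    IntervalIntegrable (deriv u) volume c d :=
  (hu.1.mono_set (ordConnected_Icc.uIcc_subset hc hd)).intervalIntegrable

lemma MemW11.sub_eq {u : ℝ → ℝ} (hu : MemW11 u) {c d : ℝ}
    (hc : c ∈ Icc (-1 : ℝ) 1) (hd : d ∈ Icc (-1 : ℝ) 1) :
    u d - u c = ∫ t in c..d, deriv u t := by
  have h1 : (-1 : ℝ) ∈ Icc (-1 : ℝ) 1 := by simp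
  rw [hu.2 d hd, hu.2 c hc, ← intervalIntegral.integral_interval_sub_left
    (hu.intervalIntegrable h1 hd) (hu.intervalIntegrable h1 hc)]
  ring

lemma MemW11.continuousOn {u : ℝ → ℝ} (hu : MemW11 u) : ContinuousOn u (Icc (-1) 1) := by
  have h : (-1 : ℝ) ≤ 1 := by norm_num
  have := intervalIntegral.continuousOn_primitive_interval (μ := volume) (f := deriv u)
    (a := -1) (b := 1) (by rw [uIcc_of_le h]; exact hu.1)
  rw [uIcc_of_le h] at this
  exact (continuousOn_const.add this).congr hu.2

lemma MemW11.bddAbove {u : ℝ → ℝ} (hu : MemW11 u) : BddAbove (u '' Icc (-1) 1) :=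
  isCompact_Icc.bddAbove_image hu.continuousOn

lemma MemW11.abs_sub_le {u v : ℝ → ℝ} (hu : MemW11 u) (hv : MemW11 v) {x : ℝ}
    (hx : x ∈ Icc (-1 : ℝ) 1) :
    |v x - u x| ≤ ∫ y in Icc (-1 : ℝ) 1, (|v y - u y| + |deriv v y - deriv u y|) := by
  set D : ℝ := ∫ y in Icc (-1 : ℝ) 1, |deriv v y - deriv u y| with hD
  have hi : IntegrableOn (fun y => |deriv v y - deriv u y|) (Icc (-1) 1) := (hv.1.sub hu.1).abs
  have hi' : IntegrableOn (fun y => |v y - u y|) (Icc (-1) 1) :=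
    (hv.continuousOn.sub hu.continuousOn).abs.integrableOn_Icc
  have hpt : ∀ y ∈ Icc (-1 : ℝ) 1, |v x - u x| - D ≤ |v y - u y| := by
    intro y hy
    have h1 : (v x - u x) - (v y - u y) = ∫ t in y..x, (deriv v t - deriv u t) := by
      rw [intervalIntegral.integral_sub (hv.intervalIntegrable hy hx)
        (hu.intervalIntegrable hy hx), ← hv.sub_eq hy hx, ← hu.sub_eq hy hx]
      ring
    have h2 : |∫ t in y..x, (deriv v t - deriv u t)| ≤ D := by
      rw [← Real.norm_eq_abs]
      refine (intervalIntegral.norm_integral_le_integral_norm_uIoc).trans ?_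
      exact setIntegral_mono_set hi (Eventually.of_forall fun _ => abs_nonneg _)
        (uIoc_subset_uIcc.trans (ordConnected_Icc.uIcc_subset hy hx)).eventuallyLE
    rw [← h1] at h2
    linarith [abs_sub_abs_le_abs_sub (v x - u x) (v y - u y)]
  have h3 : (|v x - u x| - D) * 2 ≤ ∫ y in Icc (-1 : ℝ) 1, |v y - u y| := by
    have := setIntegral_mono_on (integrableOn_const (by simp)) hi' measurableSet_Icc hpt
    rw [setIntegral_const] at this
    norm_num at this
    linarith
  rw [integral_add hi' hi, ← hD]
  have hD0 : 0 ≤ D := integral_nonneg fun _ => abs_nonneg _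
  have h0 : 0 ≤ ∫ y in Icc (-1 : ℝ) 1, |v y - u y| := integral_nonneg fun _ => abs_nonneg _
  linarith

lemma W11Tendsto.tendstoUniformlyOn {u : ℝ → ℝ} {uk : ℕ → ℝ → ℝ} (hu : MemW11 u)
    (huk : ∀ k, MemW11 (uk k)) (h : W11Tendsto uk u) :
    TendstoUniformlyOn uk u atTop (Icc (-1) 1) := by
  rw [Metric.tendstoUniformlyOn_iff]
  intro ε hε
  filter_upwards [(tendsto_order.1 h).2 ε hε] with k hk x hx
  rw [dist_comm, Real.dist_eq]
  exact (hu.abs_sub_le (huk k) hx).trans_lt hk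

/-- A continuous function passing from below `s` to above `t` crosses `(s, t)` on an interval. -/
lemma ContinuousOn.exists_crossing {f : ℝ → ℝ} {p q s t : ℝ} (hpq : p ≤ q)
    (hf : ContinuousOn f (Icc p q)) (hp : f p ≤ s) (hq : t ≤ f q) :
    ∃ c ∈ Icc p q, ∃ d ∈ Icc p q, c ≤ d ∧ f c ≤ s ∧ t ≤ f d ∧
      ∀ y ∈ Ioo c d, s < f y ∧ f y < t := by
  have hC : IsCompact (Icc p q ∩ f ⁻¹' Ici t) :=
    isCompact_Icc.of_isClosed_subset (hf.preimage_isClosed_of_isClosed isClosed_Icc isClosed_Ici)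
      inter_subset_left
  obtain ⟨d, ⟨hd, hdt⟩, hdmin⟩ := hC.exists_isLeast ⟨q, ⟨hpq, le_rfl⟩, hq⟩
  have hf' : ContinuousOn f (Icc p d) := hf.mono (Icc_subset_Icc_right hd.2)
  have hC' : IsCompact (Icc p d ∩ f ⁻¹' Iic s) :=
    isCompact_Icc.of_isClosed_subset (hf'.preimage_isClosed_of_isClosed isClosed_Icc isClosed_Iic)
      inter_subset_left
  obtain ⟨c, ⟨hc, hcs⟩, hcmax⟩ := hC'.exists_isGreatest ⟨p, ⟨le_rfl, hd.1⟩, hp⟩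
  refine ⟨c, ⟨hc.1, hc.2.trans hd.2⟩, d, hd, hc.2, hcs, hdt, fun y hy => ⟨?_, ?_⟩⟩
  · by_contra! h
    exact (hcmax ⟨⟨hc.1.trans hy.1.le, hy.2.le⟩, h⟩).not_gt hy.1
  · by_contra! h
    exact (hdmin ⟨⟨hc.1.trans hy.1.le, hy.2.le.trans hd.2⟩, h⟩).not_gt hy.2

lemma MemW11.ofReal_sub_le_lintegral {u : ℝ → ℝ} (hu : MemW11 u) {y₀ y₁ s t : ℝ}
    (hy₀ : y₀ ∈ Icc (-1 : ℝ) 1) (hy₁ : y₁ ∈ Icc (-1 : ℝ) 1) (h₀ : u y₀ ≤ s) (h₁ : t ≤ u y₁) :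
    ENNReal.ofReal (t - s) ≤
      ∫⁻ y in {y ∈ Icc (-1 : ℝ) 1 | s < u y ∧ u y < t}, ‖deriv u y‖ₑ := by
  obtain ⟨c, hc, d, hd, hcd, hval, hIoo⟩ : ∃ c ∈ Icc (-1 : ℝ) 1, ∃ d ∈ Icc (-1 : ℝ) 1, c ≤ d ∧
      t - s ≤ |u d - u c| ∧ ∀ y ∈ Ioo c d, s < u y ∧ u y < t := by
    rcases le_total y₀ y₁ with h | h
    · have hsub : Icc y₀ y₁ ⊆ Icc (-1) 1 := Icc_subset_Icc hy₀.1 hy₁.2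
      obtain ⟨c, hc, d, hd, hcd, h2, h3, h4⟩ :=
        (hu.continuousOn.mono hsub).exists_crossing h h₀ h₁
      exact ⟨c, hsub hc, d, hsub hd, hcd, le_abs.2 (Or.inl (by linarith)), h4⟩
    · have hsub : Icc y₁ y₀ ⊆ Icc (-1) 1 := Icc_subset_Icc hy₁.1 hy₀.2
      obtain ⟨c, hc, d, hd, hcd, h2, h3, h4⟩ :=
        (hu.continuousOn.mono hsub).neg.exists_crossing h (neg_le_neg h₁) (neg_le_neg h₀)
      refine ⟨c, hsub hc, d, hsub hd, hcd, le_abs.2 (Or.inr ?_), fun y hy => ?_⟩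
      · simp only [Pi.neg_apply] at h2 h3
        linarith
      · have := h4 y hy
        simp only [Pi.neg_apply, neg_lt_neg_iff] at this
        exact this.symm
  calc ENNReal.ofReal (t - s) ≤ ENNReal.ofReal |u d - u c| := ENNReal.ofReal_le_ofReal hval
    _ = ‖∫ y in Ioo c d, deriv u y‖ₑ := by
        rw [hu.sub_eq hc hd, intervalIntegral.integral_of_le hcd, integral_Ioc_eq_integral_Ioo,
          ← Real.norm_eq_abs, ofReal_norm]
    _ ≤ ∫⁻ y in Ioo c d, ‖deriv u y‖ₑ := enorm_integral_le_lintegral_enorm _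
    _ ≤ ∫⁻ y in {y ∈ Icc (-1 : ℝ) 1 | s < u y ∧ u y < t}, ‖deriv u y‖ₑ :=
        lintegral_mono_set fun y hy => ⟨⟨hc.1.trans hy.1.le, hy.2.le.trans hd.2⟩, hIoo y hy⟩

/-! ### Absolute continuity of the rearrangement -/

lemma ContinuousOn.measurableSet_inter_preimage {f : ℝ → ℝ} {s t : Set ℝ}
    (hf : ContinuousOn f s) (hs : IsClosed s) (ht : IsOpen t) : MeasurableSet (s ∩ f ⁻¹' t) := by
  have : s ∩ f ⁻¹' t = s \ (s ∩ f ⁻¹' tᶜ) := by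
    ext y
    simp
  rw [this]
  exact hs.measurableSet.diff (hf.preimage_isClosed_of_isClosed hs ht.isClosed_compl).measurableSet

/-- The part of the graph of `u` with values strictly between `mrear u a` and `mrear u b`. -/
def mrearStrip (u : ℝ → ℝ) (a b : ℝ) : Set ℝ :=
  {y ∈ Icc (-1 : ℝ) 1 | mrear u a < u y ∧ u y < mrear u b}

lemma MemW11.measurableSet_mrearStrip {u : ℝ → ℝ} (hu : MemW11 u) (a b : ℝ) :
    MeasurableSet (mrearStrip u a b) :=
  hu.continuousOn.measurableSet_inter_preimage isClosed_Icc isOpen_Ioo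

lemma MemW11.volume_mrearStrip_le {u : ℝ → ℝ} (hu : MemW11 u) {a b : ℝ} (ha : a < 1)
    (hb : b < 1) : volume (mrearStrip u a b) ≤ ENNReal.ofReal (b - a) := by
  set S : ℕ → Set ℝ := fun n => {y ∈ Icc (-1 : ℝ) 1 | mrear u a + 1 / ((n : ℝ) + 1) < u y ∧
    u y ≤ mrear u b - 1 / ((n : ℝ) + 1)} with hS
  have hmono : Monotone S := by
    rintro m n hmn y ⟨hy, h1, h2⟩
    have := Nat.one_div_le_one_div (α := ℝ) hmn
    exact ⟨hy, by linarith, by linarith⟩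
  have hunion : mrearStrip u a b ⊆ ⋃ n, S n := by
    rintro y ⟨hy, h1, h2⟩
    obtain ⟨n, hn⟩ := exists_nat_one_div_lt
      (show 0 < min (u y - mrear u a) (mrear u b - u y) from
        lt_min (sub_pos.2 h1) (sub_pos.2 h2))
    rw [lt_min_iff] at hn
    exact mem_iUnion.2 ⟨n, hy, by linarith, by linarith⟩
  refine (measure_mono hunion).trans ?_
  rw [hmono.measure_iUnion]
  refine iSup_le fun n => ?_
  have hpos : 0 < 1 / ((n : ℝ) + 1) := Nat.one_div_pos_of_nat
  set s := mrear u a + 1 / ((n : ℝ) + 1) with hs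
  set t := mrear u b - 1 / ((n : ℝ) + 1) with ht
  rcases le_or_gt t s with hts | hst
  · have : S n = ∅ := eq_empty_of_forall_notMem fun y hy => by linarith [hy.2.1, hy.2.2]
    simp [this]
  have hSn : S n = {y ∈ Icc (-1 : ℝ) 1 | u y > s} \ {y ∈ Icc (-1 : ℝ) 1 | u y > t} := by
    ext y
    simp only [hS, mem_ofPred_eq, Set.mem_sdiff]
    constructor
    · rintro ⟨hy, h1, h2⟩
      exact ⟨⟨hy, h1⟩, fun h => h2.not_gt h.2⟩
    · rintro ⟨⟨hy, h1⟩, h2⟩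
      exact ⟨hy, h1, not_lt.1 fun h => h2 ⟨hy, h⟩⟩
  have hm : MeasurableSet {y ∈ Icc (-1 : ℝ) 1 | u y > t} :=
    hu.continuousOn.measurableSet_inter_preimage isClosed_Icc isOpen_Ioi
  have hfin : volume (S n) ≠ ∞ :=
    measure_ne_top_of_subset (hSn.le.trans sdiff_subset) (superlevel_ne_top u s)
  rw [ENNReal.le_ofReal_iff_toReal_le hfin]
  · have h1 : distribFun u s < 1 - a := distribFun_lt hu.bddAbove ha (by linarith)
    have h2 : 1 - b ≤ distribFun u t :=
      le_distribFun hb.le (by linarith [mrear_nonneg u a]) (by linarith)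
    have h3 : volume.real (S n) = distribFun u s - distribFun u t := by
      have hsub : {y ∈ Icc (-1 : ℝ) 1 | u y > t} ⊆ {y ∈ Icc (-1 : ℝ) 1 | u y > s} :=
        fun y hy => ⟨hy.1, hst.trans hy.2⟩
      rw [hSn, measureReal_sdiff hsub hm (superlevel_ne_top u s)]
      rfl
    change volume.real (S n) ≤ b - a
    linarith
  · by_contra! hba
    have h1 : distribFun u s < 1 - a := distribFun_lt hu.bddAbove ha (by linarith)
    have h2 : 1 - b ≤ distribFun u t :=
      le_distribFun hb.le (by linarith [mrear_nonneg u a]) (by linarith)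
    linarith [distribFun_antitone u hst.le]

lemma MemW11.ofReal_mrear_sub_le {u : ℝ → ℝ} (hu : MemW11 u) {a b : ℝ} (ha : a ∈ Ioo (-1 : ℝ) 1)
    (hb : b ∈ Ioo (-1 : ℝ) 1) :
    ENNReal.ofReal (mrear u b - mrear u a) ≤ ∫⁻ y in mrearStrip u a b, ‖deriv u y‖ₑ := by
  rcases le_or_gt (mrear u b) (mrear u a) with h | h
  · simp [ENNReal.ofReal_of_nonpos (sub_nonpos.2 h)]
  have hlim : Tendsto (fun η : ℝ => ENNReal.ofReal ((mrear u b - η) - (mrear u a + η)))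
      (nhdsWithin 0 (Ioi 0)) (nhds (ENNReal.ofReal (mrear u b - mrear u a))) := by
    have : Continuous fun η : ℝ => ENNReal.ofReal ((mrear u b - η) - (mrear u a + η)) :=
      ENNReal.continuous_ofReal.comp (by fun_prop)
    simpa using (this.tendsto 0).mono_left nhdsWithin_le_nhds
  refine le_of_tendsto hlim ?_
  filter_upwards [Ioo_mem_nhdsGT (show (0 : ℝ) < (mrear u b - mrear u a) / 2 by linarith)]
    with η ⟨hη0, hη⟩
  have h1 := distribFun_lt hu.bddAbove ha.2 (show mrear u a < mrear u a + η by linarith)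
  have h2 := le_distribFun hb.2.le (show 0 ≤ mrear u b - η by linarith [mrear_nonneg u a])
    (show mrear u b - η < mrear u b by linarith)
  obtain ⟨y₀, hy₀, hu₀⟩ : ∃ y ∈ Icc (-1 : ℝ) 1, u y ≤ mrear u a + η := by
    by_contra! hcon
    have : {y ∈ Icc (-1 : ℝ) 1 | u y > mrear u a + η} = Icc (-1 : ℝ) 1 :=
      sep_eq_self_iff_mem_true.2 hcon
    rw [distribFun, this] at h1
    norm_num at h1
    linarith [ha.1]
  obtain ⟨y₁, hy₁, hu₁⟩ : ∃ y ∈ Icc (-1 : ℝ) 1, mrear u b - η < u y := by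
    by_contra! hcon
    rw [distribFun_eq_zero hcon] at h2
    linarith [hb.2]
  refine (hu.ofReal_sub_le_lintegral hy₀ hy₁ hu₀ hu₁.le).trans (lintegral_mono_set ?_)
  rintro y ⟨hy, h3, h4⟩
  exact ⟨hy, by linarith, by linarith⟩

lemma MemW11.disjoint_mrearStrip {u : ℝ → ℝ} (hu : MemW11 u) {a b c d : ℝ}
    (ha : a ∈ Ioo (-1 : ℝ) 1) (hb : b ∈ Ioo (-1 : ℝ) 1) (hc : c ∈ Ioo (-1 : ℝ) 1)
    (hd : d ∈ Ioo (-1 : ℝ) 1) (h : Disjoint (Ioc a b) (Ioc c d)) :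
    Disjoint (mrearStrip u a b) (mrearStrip u c d) := by
  have hmono := mrear_monotoneOn hu.bddAbove
  rw [Ioc_disjoint_Ioc] at h
  refine Set.disjoint_left.2 ?_
  rintro y ⟨-, h1, h2⟩ ⟨-, h3, h4⟩
  rcases min_le_iff.1 h with h | h <;> rcases le_max_iff.1 h with h | h
  · linarith [hmono hb ha h]
  · linarith [hmono hb hc h]
  · linarith [hmono hd ha h]
  · linarith [hmono hd hc h]

lemma MemW11.absolutelyContinuousOnInterval_mrear {u : ℝ → ℝ} (hu : MemW11 u) {α β : ℝ}
    (hα : α ∈ Ioo (-1 : ℝ) 1) (hβ : β ∈ Ioo (-1 : ℝ) 1) :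
    AbsolutelyContinuousOnInterval (mrear u) α β := by
  rw [absolutelyContinuousOnInterval_iff]
  intro ε hε
  have hint : ∫⁻ y, (Icc (-1 : ℝ) 1).indicator (fun y => ‖deriv u y‖ₑ) y ≠ ∞ := by
    rw [lintegral_indicator measurableSet_Icc]
    exact hu.1.2.ne
  obtain ⟨δ₀, hδ₀, hδ⟩ := exists_pos_setLIntegral_lt_of_measure_lt hint
    (ENNReal.ofReal_pos.2 hε).ne'
  obtain ⟨δ, hδpos, hδlt⟩ := ENNReal.lt_iff_exists_nnreal_btwn.1 hδ₀
  refine ⟨δ, by simpa using hδpos, fun E hE hlen => ?_⟩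
  set x : ℕ → ℝ := fun i => min (E.2 i).1 (E.2 i).2
  set z : ℕ → ℝ := fun i => max (E.2 i).1 (E.2 i).2
  have hmem : ∀ i ∈ Finset.range E.1, x i ∈ Ioo (-1 : ℝ) 1 ∧ z i ∈ Ioo (-1 : ℝ) 1 := by
    intro i hi
    have h1 := ordConnected_Ioo.uIcc_subset hα hβ (hE.1 i hi).1
    have h2 := ordConnected_Ioo.uIcc_subset hα hβ (hE.1 i hi).2
    exact ⟨⟨lt_min h1.1 h2.1, min_lt_of_left_lt h1.2⟩, ⟨lt_max_of_lt_left h1.1, max_lt h1.2 h2.2⟩⟩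
  have hxz : ∀ i, dist (E.2 i).1 (E.2 i).2 = z i - x i := fun i => by
    rw [Real.dist_eq, ← max_sub_min_eq_abs']
  have hw : ∀ i ∈ Finset.range E.1,
      dist (mrear u (E.2 i).1) (mrear u (E.2 i).2) = mrear u (z i) - mrear u (x i) := by
    intro i hi
    have h := mrear_monotoneOn hu.bddAbove (hmem i hi).1 (hmem i hi).2 min_le_max
    rcases le_total (E.2 i).1 (E.2 i).2 with hle | hle
    · simp only [x, z, min_eq_left hle, max_eq_right hle] at h ⊢
      rw [dist_comm, Real.dist_eq, abs_of_nonneg (sub_nonneg.2 h)]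
    · simp only [x, z, min_eq_right hle, max_eq_left hle] at h ⊢
      rw [Real.dist_eq, abs_of_nonneg (sub_nonneg.2 h)]
  have hnonneg : ∀ i ∈ Finset.range E.1, 0 ≤ mrear u (z i) - mrear u (x i) := fun i hi => by
    rw [← hw i hi]
    exact dist_nonneg
  rw [Finset.sum_congr rfl hw, ← ENNReal.ofReal_lt_ofReal_iff hε,
    ENNReal.ofReal_sum_of_nonneg hnonneg]
  set P : Set ℝ := ⋃ i ∈ Finset.range E.1, mrearStrip u (x i) (z i) with hP
  have hdisj : (↑(Finset.range E.1) : Set ℕ).PairwiseDisjoint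
      (fun i => mrearStrip u (x i) (z i)) := fun i hi j hj hij =>
    hu.disjoint_mrearStrip (hmem i hi).1 (hmem i hi).2 (hmem j hj).1 (hmem j hj).2
      (hE.2 hi hj hij)
  have hPsub : P ⊆ Icc (-1) 1 := iUnion₂_subset fun i _ y hy => hy.1
  have hvol : volume P < δ₀ := by
    calc volume P ≤ ∑ i ∈ Finset.range E.1, volume (mrearStrip u (x i) (z i)) :=
          measure_biUnion_finset_le _ _
      _ ≤ ∑ i ∈ Finset.range E.1, ENNReal.ofReal (z i - x i) :=
          Finset.sum_le_sum fun i hi => hu.volume_mrearStrip_le (hmem i hi).1.2 (hmem i hi).2.2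
      _ = ENNReal.ofReal (∑ i ∈ Finset.range E.1, (z i - x i)) :=
          (ENNReal.ofReal_sum_of_nonneg fun i _ => sub_nonneg.2 min_le_max).symm
      _ ≤ δ := by
          rw [ENNReal.ofReal_le_iff_le_toReal ENNReal.coe_ne_top, ENNReal.coe_toReal]
          simpa only [hxz] using hlen.le
      _ < δ₀ := hδlt
  calc ∑ i ∈ Finset.range E.1, ENNReal.ofReal (mrear u (z i) - mrear u (x i))
      ≤ ∑ i ∈ Finset.range E.1, ∫⁻ y in mrearStrip u (x i) (z i), ‖deriv u y‖ₑ :=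
        Finset.sum_le_sum fun i hi => hu.ofReal_mrear_sub_le (hmem i hi).1 (hmem i hi).2
    _ = ∫⁻ y in P, ‖deriv u y‖ₑ :=
        (lintegral_biUnion_finset hdisj (fun i _ => hu.measurableSet_mrearStrip _ _) _).symm
    _ = ∫⁻ y in P, (Icc (-1 : ℝ) 1).indicator (fun y => ‖deriv u y‖ₑ) y :=
        setLIntegral_congr_fun
          (Finset.measurableSet_biUnion _ fun i _ => hu.measurableSet_mrearStrip _ _)
          fun y hy => (indicator_of_mem (hPsub hy) (fun y => ‖deriv u y‖ₑ)).symm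
    _ < ENNReal.ofReal ε := hδ P hvol

/-! ### Lower semicontinuity -/

/-- A convex nondecreasing function lies above a slightly lowered secant. -/
lemma ConvexOn.secant_sub_le {f : ℝ → ℝ} (hf : ConvexOn ℝ (Ici 0) f) (hm : MonotoneOn f (Ici 0))
    {p r h : ℝ} (hp : 0 ≤ p) (hr : 0 ≤ r) (hh : 0 < h) :
    f r + (f (r + h) - f r) / h * (p - r - h) ≤ f p := by
  have hrh : 0 ≤ r + h := by linarith
  have hD : 0 ≤ (f (r + h) - f r) / h :=
    div_nonneg (sub_nonneg.2 (hm hr hrh (by linarith))) hh.le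
  have hDh : (f (r + h) - f r) / h * h = f (r + h) - f r := div_mul_cancel₀ _ hh.ne'
  rcases lt_or_ge p r with h1 | h1
  · have := hf.slope_mono_adjacent hp hrh h1 (show r < r + h by linarith)
    rw [div_le_iff₀ (by linarith), add_sub_cancel_left] at this
    nlinarith
  · rcases le_or_gt p (r + h) with h2 | h2
    · have := hm hr hp h1
      nlinarith
    · have := hf.slope_mono_adjacent hr hp (show r < r + h by linarith) h2
      rw [le_div_iff₀ (by linarith), add_sub_cancel_left] at this
      have := hm hr hrh (by linarith)
      linarith

lemma ofReal_integral_le_lintegral_ofReal {α : Type*} [MeasurableSpace α] {μ : Measure α}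
    {f : α → ℝ} (hf : Integrable f μ) :
    ENNReal.ofReal (∫ x, f x ∂μ) ≤ ∫⁻ x, ENNReal.ofReal (f x) ∂μ := by
  have h := ofReal_integral_eq_lintegral_ofReal hf.pos_part
    (Eventually.of_forall fun x => le_max_right (f x) 0)
  simp only [ENNReal.ofReal_max, ENNReal.ofReal_zero, zero_le, max_eq_left] at h
  rw [← h]
  exact ENNReal.ofReal_le_ofReal (integral_mono hf hf.pos_part fun x => le_max_left _ _)

/-- The energy density of the functional `Ifun F a`. -/
def energyDensity (F a : ℝ → ℝ → ℝ) (w : ℝ → ℝ) (x : ℝ) : ℝ≥0∞ :=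
  ENNReal.ofReal (F (w x) (a x (w x) * |deriv w x|))

lemma MonotoneOn.abs_deriv {w : ℝ → ℝ} {s : Set ℝ} (hw : MonotoneOn w s) {x : ℝ}
    (hs : s ∈ nhds x) : |deriv w x| = deriv w x := by
  rw [← derivWithin_of_mem_nhds hs, abs_of_nonneg hw.derivWithin_nonneg]

lemma eventually_ofReal_le_lintegral_energyDensity {a F : ℝ → ℝ → ℝ} (ha : Weight a)
    (hF : MemFrakF F) {w : ℝ → ℝ} {wk : ℕ → ℝ → ℝ} (hw0 : ∀ x, 0 ≤ w x)
    (hwm : MonotoneOn w (Ioo (-1) 1)) (hk0 : ∀ k x, 0 ≤ wk k x)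
    (hkm : ∀ k, MonotoneOn (wk k) (Ioo (-1) 1))
    (hkac : ∀ k, ∀ α ∈ Ioo (-1 : ℝ) 1, ∀ β ∈ Ioo (-1 : ℝ) 1,
      AbsolutelyContinuousOnInterval (wk k) α β)
    (hlim : ∀ x ∈ Ioo (-1 : ℝ) 1, Tendsto (fun k => wk k x) atTop (nhds (w x)))
    {x : ℝ} (hx : x ∈ Ioo (-1 : ℝ) 1) (hd : DifferentiableAt ℝ w x) {c : ℝ}
    (hc : c < F (w x) (a x (w x) * |deriv w x|)) :
    ∀ᶠ δ in nhdsWithin (0 : ℝ) (Ioi 0), x + δ < 1 ∧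
      ∀ᶠ k in atTop, ENNReal.ofReal (c * δ) ≤
        ∫⁻ y in Ioc x (x + δ), energyDensity F a (wk k) y := by
  obtain ⟨hFc, -, hFconv, hFmono⟩ := hF
  rw [hwm.abs_deriv (Ioo_mem_nhds hx.1 hx.2)] at hc
  have hs : 0 ≤ deriv w x := by
    rw [← hwm.abs_deriv (Ioo_mem_nhds hx.1 hx.2)]
    exact abs_nonneg _
  set s := deriv w x with hsdef
  set v₀ := w x with hv₀
  have hv₀0 : 0 ≤ v₀ := hw0 x
  have hxI : x ∈ Icc (-1 : ℝ) 1 := Ioo_subset_Icc_self hx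
  set a₀ := a x v₀ with ha₀
  have ha₀0 : 0 ≤ a₀ := ha.2 x v₀ hxI hv₀0
  set r := a₀ * s with hr
  have hr0 : 0 ≤ r := mul_nonneg ha₀0 hs
  have hFr : ∀ q, 0 ≤ q → ContinuousOn (fun v => F v q) (Ici 0) := fun q hq =>
    hFc.comp (f := fun v : ℝ => (v, q)) (by fun_prop) fun v hv => ⟨hv, hq⟩
  have hη : 0 < (F v₀ r - c) / 2 := by linarith
  set η := (F v₀ r - c) / 2 with hηdef
  obtain ⟨h, hh, hFh⟩ : ∃ h > 0, F v₀ (r + h) < F v₀ r + η := by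
    have h1 : ContinuousOn (fun q => F v₀ (r + q)) (Ici 0) :=
      hFc.comp (f := fun q : ℝ => (v₀, r + q)) (by fun_prop)
        fun q hq => ⟨hv₀0, add_nonneg hr0 hq⟩
    have h2 := (h1 0 (by simp)).tendsto
    rw [add_zero] at h2
    have h3 := (h2.mono_left (nhdsWithin_mono 0 Ioi_subset_Ici_self)).eventually_lt_const
      (show F v₀ r < F v₀ r + η by linarith)
    obtain ⟨h, h4, h5⟩ := (h3.and self_mem_nhdsWithin).exists
    exact ⟨h, h5, h4⟩
  set D : ℝ → ℝ := fun v => (F v (r + h) - F v r) / h with hDdef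
  have hDc : ContinuousOn D (Ici 0) := ((hFr (r + h) (by linarith)).sub (hFr r hr0)).div_const h
  have hDh : D v₀ * h < η := by
    rw [hDdef]
    dsimp only
    rw [div_mul_cancel₀ _ hh.ne']
    linarith
  set ε := η / (2 + s) with hε
  have hε0 : 0 < ε := div_pos hη (by linarith)
  have hεs : ε * (2 + s) = η := div_mul_cancel₀ _ (by linarith)
  set K₁ := F v₀ r - 2 * ε - D v₀ * (r + h) with hK₁
  set K₂ := D v₀ * a₀ - ε with hK₂
  have hK : c < K₁ + K₂ * s := by
    have : K₁ + K₂ * s = F v₀ r - D v₀ * h - ε * (2 + s) := by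
      rw [hK₁, hK₂, hr]
      ring
    rw [this, hεs]
    linarith
  obtain ⟨ρ, hρ, hwin⟩ : ∃ ρ > 0, ∀ y ∈ Icc (-1 : ℝ) 1, |y - x| < ρ → ∀ v, 0 ≤ v →
      |v - v₀| < ρ → F v₀ r - ε < F v r ∧ K₂ < D v * a y v ∧
        D v * (r + h) < D v₀ * (r + h) + ε := by
    have hmem : (x, v₀) ∈ Icc (-1 : ℝ) 1 ×ˢ Ici (0 : ℝ) := ⟨hxI, hv₀0⟩
    have hsnd : MapsTo Prod.snd (Icc (-1 : ℝ) 1 ×ˢ Ici (0 : ℝ)) (Ici 0) := fun p hp => hp.2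
    have c1 := ((hFr r hr0).comp continuousOn_snd hsnd) _ hmem
    have c2 := ((hDc.comp continuousOn_snd hsnd).mul ha.1) _ hmem
    have c3 := ((hDc.comp continuousOn_snd hsnd).mul_const (r + h)) _ hmem
    have e1 := c1.tendsto.eventually_const_lt (show F v₀ r - ε < F v₀ r by linarith)
    have e2 := c2.tendsto.eventually_const_lt (show K₂ < D v₀ * a x v₀ by linarith)
    have e3 := c3.tendsto.eventually_lt_const
      (show D v₀ * (r + h) < D v₀ * (r + h) + ε by linarith)
    obtain ⟨ρ, hρ, hball⟩ := Metric.mem_nhdsWithin_iff.1 (e1.and (e2.and e3))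
    refine ⟨ρ, hρ, fun y hy hyx v hv hvv => hball (a := (y, v)) ⟨?_, hy, hv⟩⟩
    rw [Metric.mem_ball, Prod.dist_eq]
    exact max_lt hyx hvv
  have hslope : Tendsto (fun δ => δ⁻¹ * (w (x + δ) - w x)) (nhdsWithin 0 (Ioi 0)) (nhds s) := by
    have := hd.hasDerivAt.tendsto_slope_zero_right
    simpa only [smul_eq_mul] using this
  have hslope' := ((hslope.const_mul K₂).const_add K₁).eventually_const_lt hK
  have hcont : Tendsto (fun δ => w (x + δ)) (nhdsWithin 0 (Ioi 0)) (nhds v₀) := by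
    have h1 : Tendsto (fun δ => x + δ) (nhdsWithin 0 (Ioi 0)) (nhds x) := by
      have : Continuous fun δ => x + δ := by fun_prop
      simpa using (this.tendsto 0).mono_left nhdsWithin_le_nhds
    exact hd.continuousAt.tendsto.comp h1
  filter_upwards [hslope', hcont.eventually_lt_const (show v₀ < v₀ + ρ by linarith),
    Ioo_mem_nhdsGT (lt_min hρ (sub_pos.2 hx.2))] with δ hδ1 hδ2 ⟨hδ0, hδ3⟩
  rw [lt_min_iff] at hδ3
  have hxδ : x + δ ∈ Ioo (-1 : ℝ) 1 := ⟨by linarith [hx.1], by linarith [hδ3.2]⟩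
  refine ⟨hxδ.2, ?_⟩
  have hlimK : Tendsto (fun k => K₁ * δ + K₂ * (wk k (x + δ) - wk k x)) atTop
      (nhds (K₁ * δ + K₂ * (w (x + δ) - w x))) :=
    (((hlim _ hxδ).sub (hlim _ hx)).const_mul K₂).const_add _
  have hcδ : c * δ < K₁ * δ + K₂ * (w (x + δ) - w x) := by
    have := mul_lt_mul_of_pos_right hδ1 hδ0
    have h2 : (K₁ + K₂ * (δ⁻¹ * (w (x + δ) - w x))) * δ
        = K₁ * δ + K₂ * (w (x + δ) - w x) := by
      field_simp
    linarith
  filter_upwards [hlimK.eventually_const_lt hcδ, (hlim _ hxδ).eventually_lt_const hδ2,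
    (hlim _ hx).eventually_const_lt (show v₀ - ρ < w x by linarith)] with k h1 h2 h3
  have hle : x ≤ x + δ := by linarith
  have hac := hkac k x hx (x + δ) hxδ
  have hint : IntegrableOn (deriv (wk k)) (Ioc x (x + δ)) :=
    (intervalIntegrable_iff_integrableOn_Ioc_of_le hle).1 hac.intervalIntegrable_deriv
  have hconst : IntegrableOn (fun _ : ℝ => K₁) (Ioc x (x + δ)) :=
    continuous_const.integrableOn_Ioc
  have hftc : ∫ y in Ioc x (x + δ), (K₁ + K₂ * deriv (wk k) y)
      = K₁ * δ + K₂ * (wk k (x + δ) - wk k x) := by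
    rw [integral_add hconst (hint.const_mul K₂), integral_const_mul,
      ← intervalIntegral.integral_of_le (f := deriv (wk k)) hle, hac.integral_deriv_eq_sub,
      setIntegral_const]
    simp [hδ0.le, mul_comm]
  calc ENNReal.ofReal (c * δ)
      ≤ ENNReal.ofReal (∫ y in Ioc x (x + δ), (K₁ + K₂ * deriv (wk k) y)) := by
        rw [hftc]
        exact ENNReal.ofReal_le_ofReal h1.le
    _ ≤ ∫⁻ y in Ioc x (x + δ), ENNReal.ofReal (K₁ + K₂ * deriv (wk k) y) :=
        ofReal_integral_le_lintegral_ofReal (hconst.add (hint.const_mul K₂))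
    _ ≤ ∫⁻ y in Ioc x (x + δ), energyDensity F a (wk k) y := by
        refine setLIntegral_mono' measurableSet_Ioc fun y hy => ENNReal.ofReal_le_ofReal ?_
        have hyI : y ∈ Ioo (-1 : ℝ) 1 := ⟨hx.1.trans hy.1, hy.2.trans_lt hxδ.2⟩
        have hyI' : y ∈ Icc (-1 : ℝ) 1 := Ioo_subset_Icc_self hyI
        have hnn := hk0 k y
        have hm1 := hkm k hx hyI hy.1.le
        have hm2 := hkm k hyI hxδ hy.2
        obtain ⟨g1, g2, g3⟩ := hwin y hyI' (by rw [abs_lt]; constructor <;> linarith [hy.1, hy.2])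
          (wk k y) hnn (by rw [abs_lt]; constructor <;> linarith)
        have hp : 0 ≤ a y (wk k y) * |deriv (wk k) y| :=
          mul_nonneg (ha.2 y _ hyI' hnn) (abs_nonneg _)
        have key := (hFconv _ hnn).secant_sub_le (hFmono _ hnn) hp hr0 hh
        have hder := (hkm k).abs_deriv (Ioo_mem_nhds hyI.1 hyI.2)
        have hder0 := abs_nonneg (deriv (wk k) y)
        rw [hder] at hder0 key ⊢
        have g2' := mul_le_mul_of_nonneg_right g2.le hder0
        have hexp : (F (wk k y) (r + h) - F (wk k y) r) / h *
            (a y (wk k y) * deriv (wk k) y - r - h)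
            = D (wk k y) * a y (wk k y) * deriv (wk k) y - D (wk k y) * (r + h) := by
          simp only [hDdef]
          ring
        rw [hexp] at key
        linarith

lemma measurable_setLIntegral_Ioc {g : ℝ → ℝ≥0∞} (hg : Measurable g) (δ : ℝ) :
    Measurable fun x => ∫⁻ y in Ioc x (x + δ), g y := by
  have hS : MeasurableSet {p : ℝ × ℝ | p.1 < p.2 ∧ p.2 ≤ p.1 + δ} :=
    (measurableSet_lt measurable_fst measurable_snd).inter
      (measurableSet_le measurable_snd (measurable_fst.add_const δ))
  have h := ((hg.comp measurable_snd).indicator hS).lintegral_prod_right' (ν := volume)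
  convert h using 2 with x
  rw [← lintegral_indicator measurableSet_Ioc]
  rfl

lemma lintegral_setLIntegral_Ioc {g : ℝ → ℝ≥0∞} (hg : Measurable g) (δ : ℝ) :
    ∫⁻ x, ∫⁻ y in Ioc x (x + δ), g y = ENNReal.ofReal δ * ∫⁻ y, g y := by
  have hS : MeasurableSet {p : ℝ × ℝ | p.1 < p.2 ∧ p.2 ≤ p.1 + δ} :=
    (measurableSet_lt measurable_fst measurable_snd).inter
      (measurableSet_le measurable_snd (measurable_fst.add_const δ))
  calc ∫⁻ x, ∫⁻ y in Ioc x (x + δ), g y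
      = ∫⁻ x, ∫⁻ y, {p : ℝ × ℝ | p.1 < p.2 ∧ p.2 ≤ p.1 + δ}.indicator
          (fun p => g p.2) (x, y) := by
        refine lintegral_congr fun x => ?_
        rw [← lintegral_indicator measurableSet_Ioc]
        rfl
    _ = ∫⁻ y, ∫⁻ x, {p : ℝ × ℝ | p.1 < p.2 ∧ p.2 ≤ p.1 + δ}.indicator
          (fun p => g p.2) (x, y) :=
        lintegral_lintegral_swap ((hg.comp measurable_snd).indicator hS).aemeasurable
    _ = ∫⁻ y, ENNReal.ofReal δ * g y := by
        refine lintegral_congr fun y => ?_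
        have : ∀ x, {p : ℝ × ℝ | p.1 < p.2 ∧ p.2 ≤ p.1 + δ}.indicator (fun p => g p.2) (x, y)
            = (Ico (y - δ) y).indicator (fun _ => g y) x := fun x => by
          simp only [indicator_apply, mem_ofPred_eq, mem_Ico, sub_le_iff_le_add]
          simp only [and_comm]
        simp_rw [this]
        rw [lintegral_indicator measurableSet_Ico, setLIntegral_const, Real.volume_Ico,
          sub_sub_cancel, mul_comm]
    _ = ENNReal.ofReal δ * ∫⁻ y, g y := lintegral_const_mul _ hg

lemma aemeasurable_energyDensity {a F : ℝ → ℝ → ℝ} (ha : Weight a) (hF : MemFrakF F)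
    {w : ℝ → ℝ} (hw0 : ∀ x, 0 ≤ w x) (hwm : MonotoneOn w (Ioo (-1) 1)) :
    AEMeasurable (energyDensity F a w) (volume.restrict (Ioo (-1) 1)) := by
  have hFc : Continuous fun p : ℝ × ℝ => F (max p.1 0) (max p.2 0) :=
    hF.1.comp_continuous (f := fun p : ℝ × ℝ => (max p.1 0, max p.2 0)) (by fun_prop)
      fun p => mk_mem_prod (mem_Ici.2 (le_max_right _ _)) (mem_Ici.2 (le_max_right _ _))
  have hac : Continuous fun p : ℝ × ℝ => a (max (-1) (min p.1 1)) (max p.2 0) :=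
    ha.1.comp_continuous (f := fun p : ℝ × ℝ => (max (-1) (min p.1 1), max p.2 0)) (by fun_prop)
      fun p => mk_mem_prod ⟨le_max_left _ _, max_le (by norm_num) (min_le_right _ _)⟩
        (mem_Ici.2 (le_max_right _ _))
  have hwmeas : AEMeasurable w (volume.restrict (Ioo (-1) 1)) :=
    aemeasurable_restrict_of_monotoneOn measurableSet_Ioo hwm
  have h1 : AEMeasurable (fun x => a (max (-1) (min x 1)) (max (w x) 0) * |deriv w x|)
      (volume.restrict (Ioo (-1) 1)) :=
    (hac.measurable.comp_aemeasurable (aemeasurable_id.prodMk hwmeas)).mul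
      (measurable_deriv w).abs.aemeasurable
  have h2 := (hFc.measurable.comp_aemeasurable (hwmeas.prodMk h1)).ennreal_ofReal
  refine h2.congr ((ae_restrict_mem measurableSet_Ioo).mono fun x hx => ?_)
  have hp : 0 ≤ a x (w x) * |deriv w x| :=
    mul_nonneg (ha.2 x _ (Ioo_subset_Icc_self hx) (hw0 x)) (abs_nonneg _)
  simp only [energyDensity, Function.comp_apply, max_eq_left (hw0 x), min_eq_left hx.2.le,
    max_eq_right hx.1.le, max_eq_left hp]

lemma Ifun_eq_lintegral_energyDensity (F a : ℝ → ℝ → ℝ) (w : ℝ → ℝ) :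
    Ifun F a w = ∫⁻ x in Ioo (-1) 1, energyDensity F a w x :=
  (setLIntegral_congr Ioo_ae_eq_Icc).symm

/-- Lower semicontinuity of the functional along pointwise convergent sequences of nondecreasing
locally absolutely continuous functions. -/
lemma Ifun_le_liminf {a F : ℝ → ℝ → ℝ} (ha : Weight a)
    (hF : MemFrakF F) {w : ℝ → ℝ} {wk : ℕ → ℝ → ℝ} (hw0 : ∀ x, 0 ≤ w x)
    (hwm : MonotoneOn w (Ioo (-1) 1)) (hk0 : ∀ k x, 0 ≤ wk k x)
    (hkm : ∀ k, MonotoneOn (wk k) (Ioo (-1) 1))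
    (hkac : ∀ k, ∀ α ∈ Ioo (-1 : ℝ) 1, ∀ β ∈ Ioo (-1 : ℝ) 1,
      AbsolutelyContinuousOnInterval (wk k) α β)
    (hlim : ∀ x ∈ Ioo (-1 : ℝ) 1, Tendsto (fun k => wk k x) atTop (nhds (w x))) :
    Ifun F a w ≤ liminf (fun k => Ifun F a (wk k)) atTop := by
  have hmeas := fun k => aemeasurable_energyDensity ha hF (hk0 k) (hkm k)
  set g : ℕ → ℝ → ℝ≥0∞ := fun k => (Ioo (-1 : ℝ) 1).indicator ((hmeas k).mk _) with hg
  have hgm : ∀ k, Measurable (g k) := fun k => (hmeas k).measurable_mk.indicator measurableSet_Ioo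
  have hgI : ∀ k, ∫⁻ x, g k x = Ifun F a (wk k) := fun k => by
    rw [lintegral_indicator measurableSet_Ioo, Ifun_eq_lintegral_energyDensity]
    exact (lintegral_congr_ae (hmeas k).ae_eq_mk).symm
  have hgloc : ∀ k, ∀ s ⊆ Ioo (-1 : ℝ) 1, MeasurableSet s →
      ∫⁻ x in s, energyDensity F a (wk k) x = ∫⁻ x in s, g k x := fun k s hs hsm => by
    rw [lintegral_congr_ae (ae_restrict_of_ae_restrict_of_subset hs (hmeas k).ae_eq_mk)]
    exact setLIntegral_congr_fun hsm fun x hx => (indicator_of_mem (hs hx) _).symm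
  set M : ℕ → ℕ → ℝ → ℝ≥0∞ := fun n k x =>
    ENNReal.ofReal ((n : ℝ) + 1) * ∫⁻ y in Ioc x (x + 1 / ((n : ℝ) + 1)), g k y with hM
  have hMm : ∀ n k, Measurable (M n k) := fun n k =>
    (measurable_setLIntegral_Ioc (hgm k) _).const_mul _
  have hMI : ∀ n k, ∫⁻ x, M n k x = Ifun F a (wk k) := fun n k => by
    have hn : (0 : ℝ) < (n : ℝ) + 1 := by positivity
    rw [lintegral_const_mul _ (measurable_setLIntegral_Ioc (hgm k) _),
      lintegral_setLIntegral_Ioc (hgm k), ← mul_assoc, ← ENNReal.ofReal_mul hn.le,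
      mul_one_div_cancel hn.ne', ENNReal.ofReal_one, one_mul, hgI]
  have hpt : ∀ᵐ x ∂volume.restrict (Ioo (-1 : ℝ) 1), energyDensity F a w x ≤
      liminf (fun n => liminf (fun k => M n k x) atTop) atTop := by
    have hd : ∀ᵐ x ∂volume.restrict (Ioo (-1 : ℝ) 1),
        DifferentiableWithinAt ℝ w (Ioo (-1) 1) x :=
      (ae_restrict_iff' measurableSet_Ioo).2 hwm.ae_differentiableWithinAt_of_mem
    filter_upwards [hd, ae_restrict_mem measurableSet_Ioo] with x hdx hx
    have hdx' := hdx.differentiableAt (Ioo_mem_nhds hx.1 hx.2)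
    refine le_of_forall_lt_imp_le_of_dense fun b hb => ?_
    have hbtop : b ≠ ∞ := hb.ne_top
    have hc : b.toReal < F (w x) (a x (w x) * |deriv w x|) :=
      (ENNReal.lt_ofReal_iff_toReal_lt hbtop).1 hb
    have hδ : Tendsto (fun n : ℕ => 1 / ((n : ℝ) + 1)) atTop (nhdsWithin 0 (Ioi 0)) :=
      tendsto_nhdsWithin_iff.2 ⟨tendsto_one_div_add_atTop_nhds_zero_nat,
        Eventually.of_forall fun n => mem_Ioi.2 Nat.one_div_pos_of_nat⟩
    refine le_liminf_of_le (by isBoundedDefault) ?_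
    filter_upwards [hδ.eventually (eventually_ofReal_le_lintegral_energyDensity ha hF hw0 hwm hk0
      hkm hkac hlim hx hdx' hc)] with n ⟨hn1, hn2⟩
    refine le_liminf_of_le (by isBoundedDefault) ?_
    filter_upwards [hn2] with k hk
    have hn : (0 : ℝ) < (n : ℝ) + 1 := by positivity
    rw [hgloc k _ (fun y hy => ⟨hx.1.trans hy.1, hy.2.trans_lt hn1⟩) measurableSet_Ioc] at hk
    calc b = ENNReal.ofReal ((n : ℝ) + 1) *
          ENNReal.ofReal (b.toReal * (1 / ((n : ℝ) + 1))) := by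
          rw [← ENNReal.ofReal_mul hn.le, mul_left_comm, mul_one_div_cancel hn.ne', mul_one,
            ENNReal.ofReal_toReal hbtop]
      _ ≤ M n k x := mul_le_mul_right hk _
  calc Ifun F a w = ∫⁻ x in Ioo (-1) 1, energyDensity F a w x :=
        Ifun_eq_lintegral_energyDensity F a w
    _ ≤ ∫⁻ x in Ioo (-1) 1, liminf (fun n => liminf (fun k => M n k x) atTop) atTop :=
        lintegral_mono_ae hpt
    _ ≤ ∫⁻ x, liminf (fun n => liminf (fun k => M n k x) atTop) atTop :=
        setLIntegral_le_lintegral _ _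
    _ ≤ liminf (fun n => ∫⁻ x, liminf (fun k => M n k x) atTop) atTop :=
        lintegral_liminf_le fun n => .liminf (hMm n)
    _ ≤ liminf (fun n => liminf (fun k => ∫⁻ x, M n k x) atTop) atTop :=
        liminf_le_liminf (Eventually.of_forall fun n => lintegral_liminf_le (hMm n))
    _ = liminf (fun k => Ifun F a (wk k)) atTop := by
        simp only [hMI, liminf_const]

/-- lifting the rearrangement inequality from a subclass `B` to `A` by
approximation in `W¹₁` with convergence of energies. -/
theorem stmt10 (a F : ℝ → ℝ → ℝ) (ha : Weight a) (hF : MemFrakF F)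
    (A B : Set (ℝ → ℝ)) (hBA : B ⊆ A)
    (hA : ∀ u ∈ A, MemW11 u ∧ ∀ x ∈ Icc (-1 : ℝ) 1, 0 ≤ u x)
    (hB : ∀ w ∈ B, Ifun F a (mrear w) ≤ Ifun F a w)
    (happrox : ∀ u ∈ A, ∃ uk : ℕ → ℝ → ℝ, (∀ k, uk k ∈ B) ∧ W11Tendsto uk u ∧
      Tendsto (fun k => Ifun F a (uk k)) atTop (nhds (Ifun F a u))) :
    ∀ u ∈ A, Ifun F a (mrear u) ≤ Ifun F a u := by
  intro u hu
  obtain ⟨uk, hukB, hconv, hI⟩ := happrox u hu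
  have huW := (hA u hu).1
  have hukW : ∀ k, MemW11 (uk k) := fun k => (hA _ (hBA (hukB k))).1
  have hunif := hconv.tendstoUniformlyOn huW hukW
  calc Ifun F a (mrear u) ≤ liminf (fun k => Ifun F a (mrear (uk k))) atTop :=
        Ifun_le_liminf ha hF (mrear_nonneg u) (mrear_monotoneOn huW.bddAbove)
          (fun k => mrear_nonneg _) (fun k => mrear_monotoneOn (hukW k).bddAbove)
          (fun k α hα β hβ => (hukW k).absolutelyContinuousOnInterval_mrear hα hβ)
          (fun x hx => tendsto_mrear huW.bddAbove (fun k => (hukW k).bddAbove) hunif hx.2)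
    _ ≤ liminf (fun k => Ifun F a (uk k)) atTop :=
        liminf_le_liminf (Eventually.of_forall fun k => hB _ (hukB k))
    _ = Ifun F a u := hI.liminf_eq
end
end

section
/- Let a : [-1,1] × [0,∞) → [0,∞) be continuous and such that for every v ≥ 0 the function x ↦ a(x,v) is nondecreasing on [-1,0] and nonincreasing on [0,1], and let F ∈ 𝔉. Then for every nonnegative function u ∈ W¹₁(-1,1) there exists a sequence of Lipschitz functions u_k : [-1,1] → [0,∞) such that u_k → u in W¹₁(-1,1) and I(a,u_k) → I(a,u). (In particular, the Lavrentiev phenomenon does not occur for I(a,·).) -/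
open MeasureTheory Set Filter
open scoped ENNReal BigOperators NNReal

noncomputable section

/-- `φ` is the inverse of the primitive of `w` that vanishes at `0`, recorded through its
consequences: `φ` slows time down by the factor `w` at the point it visits. -/
structure IsTimeChange (w φ : ℝ → ℝ) : Prop where
  measurable_weight : Measurable w
  one_le : ∀ x, 1 ≤ w x
  integrable_sub_one : Integrable fun x => w x - 1
  continuous : Continuous φ
  monotone : Monotone φ
  map_zero : φ 0 = 0
  integral_eq : ∀ x y, ∫ t in φ x..φ y, w t = y - x
  map_volume : (volume : Measure ℝ).map φ = volume.withDensity fun y => ENNReal.ofReal (w y)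
  ae_hasDerivAt : ∀ᵐ x, HasDerivAt φ (w (φ x))⁻¹ x

theorem intervalIntegrable_of_locallyIntegrable {f : ℝ → ℝ} (hf : LocallyIntegrable f volume)
    (a b : ℝ) : IntervalIntegrable f volume a b :=
  intervalIntegrable_iff.mpr
    ((hf.integrableOn_isCompact isCompact_uIcc).mono_set uIoc_subset_uIcc)

theorem locallyIntegrable_of_integrable_sub_one {w : ℝ → ℝ}
    (hwi : Integrable fun x => w x - 1) : LocallyIntegrable w volume := by
  simpa [Pi.add_def] using hwi.locallyIntegrable.add (locallyIntegrable_const (1 : ℝ))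

theorem exists_isTimeChange {w : ℝ → ℝ} (hwm : Measurable w) (hw1 : ∀ x, 1 ≤ w x)
    (hwi : Integrable fun x => w x - 1) : ∃ φ, IsTimeChange w φ := by
  have hwl := locallyIntegrable_of_integrable_sub_one hwi
  have hw : ∀ a b, IntervalIntegrable w volume a b := intervalIntegrable_of_locallyIntegrable hwl
  set ψ : ℝ → ℝ := fun y => ∫ t in (0 : ℝ)..y, w t with hψ
  have hsub : ∀ x y, ψ y - ψ x = ∫ t in x..y, w t := fun x y =>
    intervalIntegral.integral_interval_sub_left (hw _ _) (hw _ _)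
  have hge : ∀ x y, x ≤ y → y - x ≤ ψ y - ψ x := fun x y hxy => by
    rw [hsub]
    calc y - x = ∫ _ in x..y, (1 : ℝ) := by simp
      _ ≤ _ := intervalIntegral.integral_mono hxy (by simp) (hw _ _) hw1
  have hψ0 : ψ 0 = 0 := by simp [hψ]
  have hcont : Continuous ψ := intervalIntegral.continuous_primitive hw 0
  have hstrict : StrictMono ψ := fun x y hxy => by linarith [hge x y hxy.le]
  have hsurj : Function.Surjective ψ := by
    refine hcont.surjective ?_ ?_
    · refine tendsto_atTop_mono' atTop ?_ tendsto_id
      filter_upwards [eventually_ge_atTop 0] with y hy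
      have := hge 0 y hy
      simp only [id]; linarith
    · refine tendsto_atBot_mono' atBot ?_ tendsto_id
      filter_upwards [eventually_le_atBot 0] with y hy
      have := hge y 0 hy
      simp only [id]; linarith
  let e : ℝ ≃o ℝ := hstrict.orderIsoOfSurjective ψ hsurj
  have he : ∀ x, ψ (e.symm x) = x := fun x => e.apply_symm_apply x
  have he' : ∀ y, e.symm (ψ y) = y := fun y => e.symm_apply_apply y
  have hecont : Continuous e.symm := e.symm.continuous
  have hmap : (volume : Measure ℝ).map e.symm
      = volume.withDensity fun y => ENNReal.ofReal (w y) := by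
    have hIoc : ∀ ⦃a b : ℝ⦄, a < b →
        (volume : Measure ℝ).map e.symm (Ioc a b) = ENNReal.ofReal (ψ b - ψ a) := by
      intro a b _
      rw [Measure.map_apply hecont.measurable measurableSet_Ioc, ← Real.volume_Ioc]
      congr 1
      ext x
      simp only [mem_preimage, mem_Ioc]
      rw [← hstrict.lt_iff_lt, ← hstrict.le_iff_le, he]
    refine Measure.ext_of_Ioc' _ _ (fun a b hab => ?_) fun a b hab => ?_
    · rw [hIoc hab]; exact ENNReal.ofReal_ne_top
    · rw [hIoc hab, hsub, withDensity_apply _ measurableSet_Ioc,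
        intervalIntegral.integral_of_le hab.le, ofReal_integral_eq_lintegral_ofReal]
      · exact (hw a b).1
      · exact ae_of_all _ fun x => zero_le_one.trans (hw1 x)
  refine ⟨e.symm, hwm, hw1, hwi, hecont, e.symm.monotone, ?_, ?_, hmap, ?_⟩
  · rw [← hψ0, he', hψ0]
  · intro x y
    rw [← hsub, he, he]
  · have h1 : ∀ᵐ y ∂(volume : Measure ℝ).map e.symm, HasDerivAt ψ (w y) y := by
      rw [hmap]
      refine (withDensity_absolutelyContinuous _ _).ae_le ?_
      filter_upwards [_root_.LocallyIntegrable.ae_hasDerivAt_integral hwl] with y hy using hy 0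
    filter_upwards [ae_of_ae_map hecont.aemeasurable h1] with x hx
    exact hx.of_local_left_inverse hecont.continuousAt (by linarith [hw1 (e.symm x)])
      (Eventually.of_forall he)

namespace IsTimeChange

variable {w φ : ℝ → ℝ}

theorem pos (h : IsTimeChange w φ) (x : ℝ) : 0 < w x := zero_lt_one.trans_le (h.one_le x)

theorem intervalIntegrable (h : IsTimeChange w φ) (a b : ℝ) : IntervalIntegrable w volume a b :=
  intervalIntegrable_of_locallyIntegrable
    (locallyIntegrable_of_integrable_sub_one h.integrable_sub_one) a b

theorem sub_le_sub (h : IsTimeChange w φ) {x y : ℝ} (hxy : x ≤ y) : φ y - φ x ≤ y - x := by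
  rw [← h.integral_eq x y]
  calc φ y - φ x = ∫ _ in φ x..φ y, (1 : ℝ) := by simp
    _ ≤ _ := intervalIntegral.integral_mono (h.monotone hxy) (by simp) (h.intervalIntegrable _ _) h.one_le

theorem mem_Icc_zero_left (h : IsTimeChange w φ) {x : ℝ} (hx : 0 ≤ x) : φ x ∈ Icc 0 x := by
  have h1 := h.sub_le_sub hx
  have h2 := h.monotone hx
  rw [h.map_zero] at h1 h2
  exact ⟨h2, by linarith⟩

theorem mem_Icc_zero_right (h : IsTimeChange w φ) {x : ℝ} (hx : x ≤ 0) : φ x ∈ Icc x 0 := by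
  have h1 := h.sub_le_sub hx
  have h2 := h.monotone hx
  rw [h.map_zero] at h1 h2
  exact ⟨by linarith, h2⟩

theorem mapsTo_Icc (h : IsTimeChange w φ) : MapsTo φ (Icc (-1) 1) (Icc (-1) 1) := by
  intro x hx
  rcases le_total 0 x with h0 | h0
  · have := h.mem_Icc_zero_left h0
    exact ⟨by linarith [this.1], this.2.trans hx.2⟩
  · have := h.mem_Icc_zero_right h0
    exact ⟨hx.1.trans this.1, by linarith [this.2]⟩

theorem abs_sub_le (h : IsTimeChange w φ) (x : ℝ) :
    |φ x - x| ≤ ∫ t, (w t - 1) := by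
  have h1 : x - φ x = ∫ t in (0 : ℝ)..φ x, (w t - 1) := by
    rw [intervalIntegral.integral_sub (h.intervalIntegrable _ _) (by simp)]
    have := h.integral_eq 0 x
    rw [h.map_zero] at this
    simp [this]
  rw [abs_sub_comm, h1, ← Real.norm_eq_abs]
  refine intervalIntegral.norm_integral_le_integral_norm_uIoc.trans ?_
  calc ∫ t in uIoc 0 (φ x), ‖w t - 1‖ ≤ ∫ t, ‖w t - 1‖ :=
        setIntegral_le_integral h.integrable_sub_one.norm (ae_of_all _ fun t => norm_nonneg _)
    _ = _ := integral_congr_ae (ae_of_all _ fun t => by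
        simpa using h.one_le t)

theorem lintegral_comp (h : IsTimeChange w φ) {f : ℝ → ℝ≥0∞}
    (hf : Measurable f) : ∫⁻ x, f (φ x) = ∫⁻ y, ENNReal.ofReal (w y) * f y := by
  rw [← lintegral_map hf h.continuous.measurable, h.map_volume,
    lintegral_withDensity_eq_lintegral_mul _ h.measurable_weight.ennreal_ofReal hf]
  rfl

theorem integrable_comp (h : IsTimeChange w φ)
    {f : ℝ → ℝ} (hfi : Integrable fun y => w y * f y) :
    Integrable fun x => f (φ x) := by
  have : Integrable f ((volume : Measure ℝ).map φ) := by
    rw [h.map_volume, integrable_withDensity_iff_integrable_smul' h.measurable_weight.ennreal_ofReal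
      (ae_of_all _ fun _ => ENNReal.ofReal_lt_top)]
    refine hfi.congr (ae_of_all _ fun y => ?_)
    simp [ENNReal.toReal_ofReal (zero_le_one.trans (h.one_le y))]
  exact this.comp_measurable h.continuous.measurable

theorem integral_comp (h : IsTimeChange w φ)
    {f : ℝ → ℝ} (hf : Measurable f) : ∫ x, f (φ x) = ∫ y, w y * f y := by
  rw [← integral_map h.continuous.aemeasurable hf.aestronglyMeasurable, h.map_volume,
    integral_withDensity_eq_integral_toReal_smul h.measurable_weight.ennreal_ofReal
      (ae_of_all _ fun _ => ENNReal.ofReal_lt_top)]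
  refine integral_congr_ae (ae_of_all _ fun y => ?_)
  simp [ENNReal.toReal_ofReal (zero_le_one.trans (h.one_le y))]

end IsTimeChange

namespace IsTimeChange

theorem lipschitzWith_comp {w φ U g : ℝ → ℝ} (h : IsTimeChange w φ)
    (hg : LocallyIntegrable g volume) (hU : ∀ x y, U y - U x = ∫ t in x..y, g t)
    {K : ℝ≥0} (hK : ∀ t, |g t| ≤ K * w t) : LipschitzWith K (U ∘ φ) := by
  refine LipschitzWith.of_le_add_mul K ?_
  have key : ∀ x y, x ≤ y → |U (φ y) - U (φ x)| ≤ K * (y - x) := by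
    intro x y hxy
    rw [hU, ← h.integral_eq x y, ← intervalIntegral.integral_const_mul]
    refine (intervalIntegral.abs_integral_le_integral_abs (h.monotone hxy)).trans ?_
    exact intervalIntegral.integral_mono (h.monotone hxy) (intervalIntegrable_of_locallyIntegrable hg _ _).abs
      ((h.intervalIntegrable _ _).const_mul _) hK
  intro x y
  rcases le_total x y with hxy | hxy
  · have := abs_le.1 (key x y hxy)
    rw [Real.dist_eq, abs_sub_comm, abs_of_nonneg (sub_nonneg.2 hxy)]
    simp only [Function.comp]
    linarith [this.1]
  · have := abs_le.1 (key y x hxy)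
    rw [Real.dist_eq, abs_of_nonneg (sub_nonneg.2 hxy)]
    simp only [Function.comp]
    linarith [this.2]

theorem ae_deriv_comp {w φ U g : ℝ → ℝ} (h : IsTimeChange w φ)
    (hU : ∀ᵐ y, HasDerivAt U (g y) y) :
    ∀ᵐ x, deriv (U ∘ φ) x = g (φ x) / w (φ x) := by
  have h1 : ∀ᵐ y ∂(volume : Measure ℝ).map φ, HasDerivAt U (g y) y := by
    rw [h.map_volume]
    exact (withDensity_absolutelyContinuous _ _).ae_le hU
  filter_upwards [ae_of_ae_map h.continuous.aemeasurable h1, h.ae_hasDerivAt] with x hx hφ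
  rw [div_eq_mul_inv]
  exact (hx.comp x hφ).deriv

theorem tendsto_apply {w φ : ℕ → ℝ → ℝ} (h : ∀ n, IsTimeChange (w n) (φ n))
    (hlim : Tendsto (fun n => ∫ t, (w n t - 1)) atTop (nhds 0)) (x : ℝ) :
    Tendsto (fun n => φ n x) atTop (nhds x) := by
  rw [tendsto_iff_dist_tendsto_zero]
  exact squeeze_zero (fun _ => dist_nonneg) (fun n => (h n).abs_sub_le x) hlim

theorem integrable_comp_div {w φ f : ℝ → ℝ} (h : IsTimeChange w φ)
    (hf : Integrable f) : Integrable fun x => f (φ x) / w (φ x) := by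
  refine h.integrable_comp (f := fun y => f y / w y) ?_
  exact hf.congr (ae_of_all _ fun y => (mul_div_cancel₀ _ (h.pos y).ne').symm)

theorem integral_comp_div {w φ f : ℝ → ℝ} (h : IsTimeChange w φ) (hfm : Measurable f) :
    ∫ x, f (φ x) / w (φ x) = ∫ y, f y := by
  rw [h.integral_comp (f := fun y => f y / w y) (hfm.div h.measurable_weight)]
  exact integral_congr_ae (ae_of_all _ fun y => mul_div_cancel₀ _ (h.pos y).ne')

theorem tendsto_setIntegral_abs_comp_div_sub {w φ : ℕ → ℝ → ℝ} {g : ℝ → ℝ}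
    (h : ∀ n, IsTimeChange (w n) (φ n))
    (hlim : Tendsto (fun n => ∫ t, (w n t - 1)) atTop (nhds 0))
    (hgm : Measurable g) (hg : Integrable g) {s : Set ℝ} (hs : volume s ≠ ∞) :
    Tendsto (fun n => ∫ x in s, |g (φ n x) / w n (φ n x) - g x|) atTop (nhds 0) := by
  have : IsFiniteMeasure (volume.restrict s) := ⟨by simpa using hs.lt_top⟩
  rw [Metric.tendsto_atTop']
  intro ε hε
  obtain ⟨f, hfs, hfε, hfc, hfi⟩ :=
    hg.exists_hasCompactSupport_integral_sub_le (show 0 < ε / 4 by positivity)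
  obtain ⟨C, hC⟩ := hfc.bounded_above_of_compact_support hfs
  have hC0 : 0 ≤ C := (norm_nonneg _).trans (hC 0)
  have hdct : Tendsto (fun n => ∫ x in s, |f (φ n x) - f x|) atTop (nhds 0) := by
    have := tendsto_integral_of_dominated_convergence (μ := volume.restrict s)
      (F := fun n x => |f (φ n x) - f x|) (f := fun _ => (0 : ℝ)) (fun _ => C + C)
      (fun n => ((hfc.comp (h n).continuous).sub hfc).abs.aestronglyMeasurable)
      (integrable_const _)
      (fun n => ae_of_all _ fun x => by
        rw [Real.norm_eq_abs, abs_abs]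
        exact (abs_sub _ _).trans (add_le_add (hC _) (hC _)))
      (ae_of_all _ fun x => by
        have := (((hfc.tendsto x).comp (tendsto_apply h hlim x)).sub_const (f x)).abs
        simpa using this)
    simpa using this
  have hsmall : Tendsto (fun n => (∫ x in s, |f (φ n x) - f x|) + C * ∫ t, (w n t - 1))
      atTop (nhds 0) := by
    simpa using hdct.add (hlim.const_mul C)
  obtain ⟨N, hN⟩ := (Metric.tendsto_atTop'.1 hsmall) (ε / 2) (by positivity)
  refine ⟨N, fun n hn => ?_⟩
  have hn' := hN n hn
  rw [Real.dist_eq, sub_zero] at hn' ⊢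
  rw [abs_of_nonneg (integral_nonneg fun x => abs_nonneg _)]
  have hw := h n
  have hgf : Integrable fun y => |g y - f y| := (hg.sub hfi).abs
  have hgfm : Measurable fun y => |g y - f y| := by
    have := hfc.measurable
    fun_prop
  have i1 : Integrable fun x => |g (φ n x) - f (φ n x)| / w n (φ n x) :=
    hw.integrable_comp_div hgf
  have i2 : IntegrableOn (fun x => |f (φ n x) - f x|) s := by
    refine Integrable.of_bound
      ((hfc.comp hw.continuous).sub hfc).abs.aestronglyMeasurable (C + C)
      (ae_of_all _ fun x => ?_)
    rw [Real.norm_eq_abs, abs_abs]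
    exact (abs_sub _ _).trans (add_le_add (hC _) (hC _))
  have hwm : Measurable fun y => w n y - 1 := hw.measurable_weight.sub_const 1
  have i3 : Integrable fun x => C * ((w n (φ n x) - 1) / w n (φ n x)) :=
    (hw.integrable_comp_div hw.integrable_sub_one).const_mul C
  have hpt : ∀ x, |g (φ n x) / w n (φ n x) - g x| ≤
      (|g (φ n x) - f (φ n x)| / w n (φ n x) + |f (φ n x) - f x|)
        + (C * ((w n (φ n x) - 1) / w n (φ n x)) + |g x - f x|) := by
    intro x
    have hp := hw.pos (φ n x)
    have h1 := hw.one_le (φ n x)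
    have e : g (φ n x) / w n (φ n x) - g x =
        (g (φ n x) - f (φ n x)) / w n (φ n x) + (f (φ n x) - f x) / w n (φ n x)
          + (-(f x * ((w n (φ n x) - 1) / w n (φ n x))) + (f x - g x)) := by
      field_simp; ring
    rw [e]
    refine (abs_add_le _ _).trans (add_le_add ((abs_add_le _ _).trans (add_le_add ?_ ?_))
      ((abs_add_le _ _).trans (add_le_add ?_ ?_)))
    · rw [abs_div, abs_of_pos hp]
    · rw [abs_div, abs_of_pos hp]
      exact div_le_self (abs_nonneg _) h1
    · have h0 : 0 ≤ (w n (φ n x) - 1) / w n (φ n x) := div_nonneg (by linarith) hp.le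
      rw [abs_neg, abs_mul, abs_of_nonneg h0]
      exact mul_le_mul_of_nonneg_right (hC x) h0
    · rw [abs_sub_comm]
  have b1 : ∫ x in s, |g (φ n x) - f (φ n x)| / w n (φ n x) ≤ ε / 4 := by
    refine (setIntegral_le_integral i1 (ae_of_all _ fun x =>
      div_nonneg (abs_nonneg _) (hw.pos _).le)).trans ?_
    rw [hw.integral_comp_div hgfm]
    exact hfε
  have b3 : ∫ x in s, C * ((w n (φ n x) - 1) / w n (φ n x)) ≤ C * ∫ t, (w n t - 1) := by
    refine (setIntegral_le_integral i3 (ae_of_all _ fun x => mul_nonneg hC0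
      (div_nonneg (by linarith [hw.one_le (φ n x)]) (hw.pos _).le))).trans ?_
    rw [integral_const_mul, hw.integral_comp_div hwm]
  have b4 : ∫ x in s, |g x - f x| ≤ ε / 4 :=
    (setIntegral_le_integral hgf (ae_of_all _ fun x => abs_nonneg _)).trans hfε
  have i4 : IntegrableOn (fun x => |g x - f x|) s := hgf.integrableOn
  have i12 := i1.integrableOn.add i2
  have i34 := i3.integrableOn.add i4
  have hle := integral_mono_of_nonneg (μ := volume.restrict s)
    (ae_of_all _ fun x => abs_nonneg (g (φ n x) / w n (φ n x) - g x)) (i12.add i34)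
    (ae_of_all _ hpt)
  have hsum := integral_add i12 i34
  have hsum1 := integral_add i1.integrableOn i2
  have hsum2 := integral_add i3.integrableOn i4
  simp only [Pi.add_apply] at hle hsum hsum1 hsum2
  have := le_abs_self ((∫ x in s, |f (φ n x) - f x|) + C * ∫ t, (w n t - 1))
  linarith

end IsTimeChange

/-- The energy of the pair `(u, d)`, where `d` stands for the derivative of `u`. -/
def energy (F a : ℝ → ℝ → ℝ) (u d : ℝ → ℝ) : ℝ≥0∞ :=
  ∫⁻ x in Icc (-1 : ℝ) 1, ENNReal.ofReal (F (u x) (a x (u x) * |d x|))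

theorem measurable_energy_density {F a : ℝ → ℝ → ℝ} (hF : Continuous fun p : ℝ × ℝ => F p.1 p.2)
    (ha : Continuous fun p : ℝ × ℝ => a p.1 p.2) {u d : ℝ → ℝ} (hu : Continuous u)
    (hd : Measurable d) :
    Measurable fun x => ENNReal.ofReal (F (u x) (a x (u x) * |d x|)) := by
  have h1 : Measurable fun x => a x (u x) * |d x| :=
    (ha.comp (continuous_id.prodMk hu)).measurable.mul hd.abs
  exact (hF.measurable.comp (hu.measurable.prodMk h1)).ennreal_ofReal

theorem energy_le_liminf {F a : ℝ → ℝ → ℝ} (hF : Continuous fun p : ℝ × ℝ => F p.1 p.2)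
    (ha : Continuous fun p : ℝ × ℝ => a p.1 p.2) {u d : ℝ → ℝ} {uk dk : ℕ → ℝ → ℝ}
    (huk : ∀ n, Continuous (uk n)) (hdk : ∀ n, Measurable (dk n))
    (hu : ∀ x, Tendsto (fun n => uk n x) atTop (nhds (u x)))
    (hd : ∀ᵐ x ∂volume.restrict (Icc (-1 : ℝ) 1),
      Tendsto (fun n => dk n x) atTop (nhds (d x))) :
    energy F a u d ≤ liminf (fun n => energy F a (uk n) (dk n)) atTop := by
  refine le_trans (lintegral_mono_ae ?_) (lintegral_liminf_le fun n =>
    measurable_energy_density hF ha (huk n) (hdk n))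
  filter_upwards [hd] with x hx
  refine (Tendsto.liminf_eq ?_).ge
  refine (ENNReal.continuous_ofReal.tendsto _).comp ?_
  have h1 : Tendsto (fun n => a x (uk n x)) atTop (nhds (a x (u x))) :=
    (ha.tendsto (x, u x)).comp (tendsto_const_nhds.prodMk_nhds (hu x))
  exact (hF.tendsto (u x, a x (u x) * |d x|)).comp ((hu x).prodMk_nhds (h1.mul hx.abs))

theorem ConvexOn.apply_div_le {f : ℝ → ℝ} (hf : ConvexOn ℝ (Ici 0) f) {p w : ℝ} (hp : 0 ≤ p)
    (hw : 1 ≤ w) : f (p / w) ≤ f p / w + (w - 1) / w * f 0 := by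
  have hw0 : 0 < w := by linarith
  have h1 : 0 ≤ 1 / w := by positivity
  have h2 : 0 ≤ (w - 1) / w := div_nonneg (by linarith) hw0.le
  have := hf.2 (mem_Ici.2 hp) (mem_Ici.2 le_rfl) h1 h2 (by field_simp; ring)
  simp only [smul_eq_mul, mul_zero, add_zero] at this
  rw [one_div_mul_eq_div, one_div_mul_eq_div] at this
  exact this

theorem IsTimeChange.le_apply_of_monotone_antitone {w φ b : ℝ → ℝ} (h : IsTimeChange w φ)
    (hb : MonotoneOn b (Icc (-1) 0) ∧ AntitoneOn b (Icc 0 1)) {x : ℝ} (hx : x ∈ Icc (-1 : ℝ) 1) :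
    b x ≤ b (φ x) := by
  rcases le_total 0 x with h0 | h0
  · have := h.mem_Icc_zero_left h0
    exact hb.2 ⟨this.1, this.2.trans hx.2⟩ ⟨h0, hx.2⟩ this.2
  · have := h.mem_Icc_zero_right h0
    exact hb.1 ⟨hx.1, h0⟩ ⟨hx.1.trans this.1, this.2⟩ this.1

theorem IsTimeChange.energy_comp_le {F a : ℝ → ℝ → ℝ}
    (hF : Continuous fun p : ℝ × ℝ => F p.1 p.2) (hF0 : ∀ v p, 0 ≤ F v p)
    (hFconv : ∀ v, ConvexOn ℝ (Ici 0) (F v)) (hFmono : ∀ v, MonotoneOn (F v) (Ici 0))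
    (ha : Continuous fun p : ℝ × ℝ => a p.1 p.2) (ha0 : ∀ x v, 0 ≤ a x v)
    (hmono : ∀ v : ℝ, MonotoneOn (fun x => a x v) (Icc (-1 : ℝ) 0) ∧
      AntitoneOn (fun x => a x v) (Icc (0 : ℝ) 1))
    {w φ U g : ℝ → ℝ} (h : IsTimeChange w φ) (hU : Continuous U) (hg : Measurable g)
    {M : ℝ} (hM : ∀ y ∈ Icc (-1 : ℝ) 1, F (U y) 0 ≤ M) :
    energy F a (U ∘ φ) (fun x => g (φ x) / w (φ x)) ≤
      energy F a U g + ENNReal.ofReal (M * ∫ t, (w t - 1)) := by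
  have hM0 : 0 ≤ M := (hF0 _ _).trans (hM 0 (by norm_num))
  have hwm := h.measurable_weight
  have hEm := measurable_energy_density hF ha hU hg
  set E : ℝ → ℝ≥0∞ := fun y => ENNReal.ofReal (F (U y) (a y (U y) * |g y|)) with hE
  set R : ℝ → ℝ≥0∞ := fun y => ENNReal.ofReal (w y)⁻¹ *
    ((Icc (-1 : ℝ) 1).indicator E y + ENNReal.ofReal (M * (w y - 1))) with hR
  have hEim : Measurable ((Icc (-1 : ℝ) 1).indicator E) := hEm.indicator measurableSet_Icc
  have hRm : Measurable R := by
    refine hwm.inv.ennreal_ofReal.mul (hEim.add ?_)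
    exact ((hwm.sub_const 1).const_mul M).ennreal_ofReal
  calc energy F a (U ∘ φ) (fun x => g (φ x) / w (φ x))
      ≤ ∫⁻ x in Icc (-1 : ℝ) 1, R (φ x) := by
        refine setLIntegral_mono (hRm.comp h.continuous.measurable) fun x hx => ?_
        have hφ := h.mapsTo_Icc hx
        simp only [hR, indicator_of_mem hφ, hE, Function.comp]
        set y := φ x with hy
        have hw := h.pos y
        have hw1 := h.one_le y
        rw [← ENNReal.ofReal_add (hF0 _ _) (mul_nonneg hM0 (by linarith)),
          ← ENNReal.ofReal_mul (by positivity)]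
        refine ENNReal.ofReal_le_ofReal ?_
        have hax : a x (U y) ≤ a y (U y) := h.le_apply_of_monotone_antitone (hmono (U y)) hx
        have hp : 0 ≤ a y (U y) * |g y| := mul_nonneg (ha0 _ _) (abs_nonneg _)
        calc F (U y) (a x (U y) * |g y / w y|)
            ≤ F (U y) (a y (U y) * |g y| / w y) := by
              refine hFmono _ (mem_Ici.2 (mul_nonneg (ha0 _ _) (abs_nonneg _)))
                (mem_Ici.2 (div_nonneg hp hw.le)) ?_
              rw [abs_div, abs_of_pos hw, mul_div_assoc]
              exact mul_le_mul_of_nonneg_right hax (div_nonneg (abs_nonneg _) hw.le)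
          _ ≤ F (U y) (a y (U y) * |g y|) / w y + (w y - 1) / w y * F (U y) 0 :=
              ConvexOn.apply_div_le (hFconv _) hp hw1
          _ ≤ F (U y) (a y (U y) * |g y|) / w y + (w y - 1) / w y * M :=
              add_le_add le_rfl (mul_le_mul_of_nonneg_left (hM y hφ)
                (div_nonneg (by linarith) hw.le))
          _ = _ := by field_simp
    _ ≤ ∫⁻ x, R (φ x) := setLIntegral_le_lintegral _ _
    _ = ∫⁻ y, ((Icc (-1 : ℝ) 1).indicator E y + ENNReal.ofReal (M * (w y - 1))) := by
        rw [h.lintegral_comp hRm]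
        refine lintegral_congr fun y => ?_
        rw [hR, ← mul_assoc, ← ENNReal.ofReal_mul (h.pos y).le,
          mul_inv_cancel₀ (h.pos y).ne', ENNReal.ofReal_one, one_mul]
    _ = energy F a U g + ENNReal.ofReal (M * ∫ t, (w t - 1)) := by
        rw [lintegral_add_left hEim, lintegral_indicator measurableSet_Icc,
          ← integral_const_mul, ofReal_integral_eq_lintegral_ofReal
            (h.integrable_sub_one.const_mul M)
            (ae_of_all _ fun y => mul_nonneg hM0 (by linarith [h.one_le y]))]
        rfl

theorem exists_seq_isTimeChange {g : ℝ → ℝ} (hgm : Measurable g) (hg : Integrable g) :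
    ∃ w φ : ℕ → ℝ → ℝ, (∀ n, IsTimeChange (w n) (φ n)) ∧
      (∀ n, ∃ K : ℝ≥0, ∀ t, |g t| ≤ K * w n t) ∧
      Tendsto (fun n => ∫ t, (w n t - 1)) atTop (nhds 0) := by
  set w : ℕ → ℝ → ℝ := fun n t => max 1 (|g t| / (n + 1)) with hw
  have hpos : ∀ n : ℕ, (0 : ℝ) < n + 1 := fun n => by positivity
  have hw1 : ∀ n t, 1 ≤ w n t := fun n t => le_max_left _ _
  have hwm : ∀ n, Measurable (w n) := fun n => measurable_const.max (hgm.abs.div_const _)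
  have hle : ∀ n t, w n t - 1 ≤ |g t| / (n + 1) := fun n t => by
    have : 0 ≤ |g t| / ((n : ℝ) + 1) := by positivity
    have : w n t ≤ |g t| / (n + 1) + 1 := max_le (by linarith) (by linarith)
    linarith
  have hi : ∀ n : ℕ, Integrable fun t => |g t| / ((n : ℝ) + 1) := fun n => hg.abs.div_const _
  have hwi : ∀ n, Integrable fun t => w n t - 1 := fun n => by
    refine (hi n).mono' ((hwm n).sub_const 1).aestronglyMeasurable (ae_of_all _ fun t => ?_)
    rw [Real.norm_eq_abs, abs_of_nonneg (sub_nonneg.2 (hw1 n t))]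
    exact hle n t
  choose φ hφ using fun n => exists_isTimeChange (hwm n) (hw1 n) (hwi n)
  refine ⟨w, φ, hφ, fun n => ⟨n + 1, fun t => ?_⟩, ?_⟩
  · push_cast
    rw [mul_comm, ← div_le_iff₀ (hpos n)]
    exact le_max_right _ _
  · refine squeeze_zero (fun n => integral_nonneg fun t => sub_nonneg.2 (hw1 n t))
      (fun n => integral_mono (hwi n) (hi n) (hle n)) ?_
    simp only [integral_div]
    exact tendsto_const_nhds.div_atTop
      (tendsto_atTop_add_const_right _ _ tendsto_natCast_atTop_atTop)

theorem exists_subseq_tendsto_ae_of_integral_abs_sub {μ : Measure ℝ} {d : ℕ → ℝ → ℝ} {g : ℝ → ℝ}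
    (hd : ∀ n, Integrable (d n) μ) (hg : Integrable g μ)
    (h : Tendsto (fun n => ∫ x, |d n x - g x| ∂μ) atTop (nhds 0)) :
    ∃ ns : ℕ → ℕ, StrictMono ns ∧
      ∀ᵐ x ∂μ, Tendsto (fun k => d (ns k) x) atTop (nhds (g x)) := by
  refine (tendstoInMeasure_of_tendsto_eLpNorm one_ne_zero
    (fun n => (hd n).aestronglyMeasurable) hg.aestronglyMeasurable ?_).exists_seq_tendsto_ae
  have e : ∀ n, eLpNorm (d n - g) 1 μ = ENNReal.ofReal (∫ x, |d n x - g x| ∂μ) := fun n => by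
    rw [eLpNorm_one_eq_lintegral_enorm, ← ofReal_integral_norm_eq_lintegral_enorm ((hd n).sub hg)]
    rfl
  simp only [e]
  simpa using ENNReal.tendsto_ofReal h

/-- Lipschitz approximation in energy along time changes, for globally defined data. -/
theorem exists_lipschitz_tendsto_energy {F a : ℝ → ℝ → ℝ}
    (hF : Continuous fun p : ℝ × ℝ => F p.1 p.2) (hF0 : ∀ v p, 0 ≤ F v p)
    (hFconv : ∀ v, ConvexOn ℝ (Ici 0) (F v)) (hFmono : ∀ v, MonotoneOn (F v) (Ici 0))
    (ha : Continuous fun p : ℝ × ℝ => a p.1 p.2) (ha0 : ∀ x v, 0 ≤ a x v)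
    (hmono : ∀ v : ℝ, MonotoneOn (fun x => a x v) (Icc (-1 : ℝ) 0) ∧
      AntitoneOn (fun x => a x v) (Icc (0 : ℝ) 1))
    {U g : ℝ → ℝ} (hgm : Measurable g) (hg : Integrable g)
    (hU : ∀ x y, U y - U x = ∫ t in x..y, g t) :
    ∃ φ : ℕ → ℝ → ℝ, (∀ k, MapsTo (φ k) (Icc (-1) 1) (Icc (-1) 1)) ∧
      (∀ k, ∃ K : ℝ≥0, LipschitzWith K (U ∘ φ k)) ∧
      Tendsto (fun k => ∫ x in Icc (-1 : ℝ) 1,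
        (|(U ∘ φ k) x - U x| + |deriv (U ∘ φ k) x - g x|)) atTop (nhds 0) ∧
      Tendsto (fun k => energy F a (U ∘ φ k) (deriv (U ∘ φ k))) atTop
        (nhds (energy F a U g)) := by
  obtain ⟨w, φ, hφ, hK, hlim⟩ := exists_seq_isTimeChange hgm hg
  have hUeq : U = fun y => U 0 + ∫ t in (0 : ℝ)..y, g t := by
    ext y; rw [← hU]; ring
  have hgl : LocallyIntegrable g volume := hg.locallyIntegrable
  have hUc : Continuous U := by
    rw [hUeq]
    exact continuous_const.add (intervalIntegral.continuous_primitive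
      (intervalIntegrable_of_locallyIntegrable hgl) 0)
  have hUd : ∀ᵐ y, HasDerivAt U (g y) y := by
    filter_upwards [_root_.LocallyIntegrable.ae_hasDerivAt_integral hgl] with y hy
    rw [hUeq]
    exact (hy 0).const_add _
  obtain ⟨M, hM⟩ := isCompact_Icc.exists_bound_of_continuousOn (s := Icc (-1 : ℝ) 1)
    (f := fun y => F (U y) 0) (hF.comp (hUc.prodMk continuous_const)).continuousOn
  set d : ℕ → ℝ → ℝ := fun n x => g (φ n x) / w n (φ n x) with hd
  have hdi : ∀ n, Integrable (d n) := fun n => (hφ n).integrable_comp_div hg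
  have hdm : ∀ n, Measurable (d n) := fun n =>
    (hgm.div (hφ n).measurable_weight).comp (hφ n).continuous.measurable
  have hdL1 : Tendsto (fun n => ∫ x in Icc (-1 : ℝ) 1, |d n x - g x|) atTop (nhds 0) :=
    IsTimeChange.tendsto_setIntegral_abs_comp_div_sub hφ hlim hgm hg (by simp)
  have hUφ : ∀ x, Tendsto (fun n => U (φ n x)) atTop (nhds (U x)) := fun x =>
    (hUc.tendsto x).comp (IsTimeChange.tendsto_apply hφ hlim x)
  have hUL1 : Tendsto (fun n => ∫ x in Icc (-1 : ℝ) 1, |U (φ n x) - U x|) atTop (nhds 0) := by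
    obtain ⟨C, hC⟩ := isCompact_Icc.exists_bound_of_continuousOn (s := Icc (-1 : ℝ) 1)
      hUc.continuousOn
    have := tendsto_integral_of_dominated_convergence (μ := volume.restrict (Icc (-1 : ℝ) 1))
      (F := fun n x => |U (φ n x) - U x|) (f := fun _ => (0 : ℝ)) (fun _ => C + C)
      (fun n => ((hUc.comp (hφ n).continuous).sub hUc).abs.aestronglyMeasurable)
      (integrable_const _)
      (fun n => (ae_restrict_mem measurableSet_Icc).mono fun x hx => by
        rw [Real.norm_eq_abs, abs_abs]
        exact (abs_sub _ _).trans (add_le_add (hC _ ((hφ n).mapsTo_Icc hx)) (hC _ hx)))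
      (ae_of_all _ fun x => by
        simpa using ((hUφ x).sub_const (U x)).abs)
    simpa using this
  have hderiv : ∀ n, deriv (U ∘ φ n) =ᵐ[volume] d n := fun n => (hφ n).ae_deriv_comp hUd
  have henergy : ∀ n, energy F a (U ∘ φ n) (deriv (U ∘ φ n)) = energy F a (U ∘ φ n) (d n) :=
    fun n => lintegral_congr_ae (ae_restrict_of_ae ((hderiv n).mono fun x hx => by
      simp only [hx]))
  obtain ⟨ns, hns, hae⟩ := exists_subseq_tendsto_ae_of_integral_abs_sub
    (fun n => (hdi n).integrableOn (s := Icc (-1 : ℝ) 1)) hg.integrableOn hdL1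
  refine ⟨fun k => φ (ns k), fun k => (hφ _).mapsTo_Icc, fun k => ?_, ?_, ?_⟩
  · obtain ⟨K, hK⟩ := hK (ns k)
    exact ⟨K, (hφ _).lipschitzWith_comp hgl hU hK⟩
  · have hsum : ∀ n, ∫ x in Icc (-1 : ℝ) 1, (|(U ∘ φ n) x - U x| + |deriv (U ∘ φ n) x - g x|)
        = (∫ x in Icc (-1 : ℝ) 1, |U (φ n x) - U x|) + ∫ x in Icc (-1 : ℝ) 1, |d n x - g x| := by
      intro n
      rw [← integral_add]
      · refine integral_congr_ae (ae_restrict_of_ae ((hderiv n).mono fun x hx => ?_))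
        simp only [hx, Function.comp]
      · exact ((hUc.comp (hφ n).continuous).sub hUc).abs.continuousOn.integrableOn_compact
          isCompact_Icc
      · exact ((hdi n).sub hg).abs.integrableOn
    simp only [hsum]
    simpa [Function.comp_def] using (hUL1.add hdL1).comp hns.tendsto_atTop
  · simp only [henergy]
    refine tendsto_of_le_liminf_of_limsup_le ?_ ?_
    · exact energy_le_liminf hF ha (fun k => hUc.comp (hφ _).continuous) (fun k => hdm _)
        (fun x => (hUφ x).comp hns.tendsto_atTop) hae
    · have hbound : ∀ k, energy F a (U ∘ φ (ns k)) (d (ns k)) ≤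
          energy F a U g + ENNReal.ofReal (M * ∫ t, (w (ns k) t - 1)) := fun k =>
        (hφ _).energy_comp_le hF hF0 hFconv hFmono ha ha0 hmono hUc hgm
          fun y hy => (le_abs_self _).trans (hM y hy)
      have hz : Tendsto (fun k => ENNReal.ofReal (M * ∫ t, (w (ns k) t - 1))) atTop (nhds 0) := by
        simpa using ENNReal.tendsto_ofReal ((hlim.comp hns.tendsto_atTop).const_mul M)
      have hlim' := (tendsto_const_nhds (x := energy F a U g)).add hz
      rw [add_zero] at hlim'
      exact (limsup_le_limsup (Eventually.of_forall hbound)).trans hlim'.limsup_eq.le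

/-- absence of the Lavrentiev phenomenon for weights nondecreasing on `[-1,0]`
and nonincreasing on `[0,1]`. -/
theorem stmt12 (a F : ℝ → ℝ → ℝ) (ha : Weight a) (hF : MemFrakF F)
    (hmono : ∀ v : ℝ, 0 ≤ v → MonotoneOn (fun x => a x v) (Icc (-1 : ℝ) 0) ∧
      AntitoneOn (fun x => a x v) (Icc (0 : ℝ) 1))
    (u : ℝ → ℝ) (hu : MemW11 u) (hnn : ∀ x ∈ Icc (-1 : ℝ) 1, 0 ≤ u x) :
    ∃ uk : ℕ → ℝ → ℝ,
      (∀ k, ∃ K : ℝ≥0, LipschitzOnWith K (uk k) (Icc (-1 : ℝ) 1)) ∧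
      (∀ k, ∀ x ∈ Icc (-1 : ℝ) 1, 0 ≤ uk k x) ∧
      W11Tendsto uk u ∧
      Tendsto (fun k => Ifun F a (uk k)) atTop (nhds (Ifun F a u)) := by
  obtain ⟨hac, ha0⟩ := ha
  obtain ⟨hFc, hF0, hFconv, hFmono⟩ := hF
  obtain ⟨hui, hueq⟩ := hu
  set c : ℝ → ℝ := fun x => max (-1) (min x 1) with hc
  have hcmem : ∀ x, c x ∈ Icc (-1 : ℝ) 1 := fun x =>
    ⟨le_max_left _ _, max_le (by norm_num) (min_le_right _ _)⟩
  have hcid : ∀ x ∈ Icc (-1 : ℝ) 1, c x = x := fun x hx => by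
    simp only [hc, min_eq_left hx.2, max_eq_right hx.1]
  have hccont : Continuous c := by fun_prop
  set a' : ℝ → ℝ → ℝ := fun x v => a (c x) (max v 0) with ha'
  set F' : ℝ → ℝ → ℝ := fun v p => F (max v 0) (max p 0) with hF'
  have hF'p : ∀ v, EqOn (F (max v 0)) (F' v) (Ici 0) := fun v p hp => by
    simp only [hF', max_eq_left (mem_Ici.1 hp)]
  have ha'c : Continuous fun p : ℝ × ℝ => a' p.1 p.2 :=
    hac.comp_continuous (f := fun p : ℝ × ℝ => (c p.1, max p.2 0)) (by fun_prop)
      fun p => ⟨hcmem _, mem_Ici.2 (le_max_right _ _)⟩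
  have hF'c : Continuous fun p : ℝ × ℝ => F' p.1 p.2 :=
    hFc.comp_continuous (f := fun p : ℝ × ℝ => (max p.1 0, max p.2 0)) (by fun_prop)
      fun p => ⟨mem_Ici.2 (le_max_right _ _), mem_Ici.2 (le_max_right _ _)⟩
  have hmono' : ∀ v : ℝ, MonotoneOn (fun x => a' x v) (Icc (-1 : ℝ) 0) ∧
      AntitoneOn (fun x => a' x v) (Icc (0 : ℝ) 1) := fun v => by
    obtain ⟨h1, h2⟩ := hmono (max v 0) (le_max_right _ _)
    refine ⟨h1.congr fun x hx => ?_, h2.congr fun x hx => ?_⟩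
    · simp only [ha', hcid x ⟨hx.1, hx.2.trans zero_le_one⟩]
    · simp only [ha', hcid x ⟨by linarith [hx.1], hx.2⟩]
  set g : ℝ → ℝ := (Icc (-1 : ℝ) 1).indicator (deriv u) with hg
  have hgm : Measurable g := (measurable_deriv u).indicator measurableSet_Icc
  have hgi : Integrable g := hui.integrable_indicator measurableSet_Icc
  have hgid : ∀ x ∈ Icc (-1 : ℝ) 1, g x = deriv u x := fun x hx => indicator_of_mem hx _
  set U : ℝ → ℝ := fun x => u (-1) + ∫ t in (-1 : ℝ)..x, g t with hU
  have hUu : ∀ x ∈ Icc (-1 : ℝ) 1, U x = u x := fun x hx => by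
    rw [hueq x hx]
    simp only [hU]
    congr 1
    refine intervalIntegral.integral_congr fun t ht => ?_
    rw [uIcc_of_le hx.1] at ht
    exact hgid t ⟨ht.1, ht.2.trans hx.2⟩
  have hUsub : ∀ x y, U y - U x = ∫ t in x..y, g t := fun x y => by
    simp only [hU, add_sub_add_left_eq_sub]
    exact intervalIntegral.integral_interval_sub_left hgi.intervalIntegrable
      hgi.intervalIntegrable
  have hE : ∀ v d : ℝ → ℝ, (∀ x ∈ Icc (-1 : ℝ) 1, 0 ≤ v x) →
      energy F' a' v d = energy F a v d := fun v d hv => by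
    refine setLIntegral_congr_fun measurableSet_Icc fun x hx => ?_
    have h1 : a' x (v x) = a x (v x) := by simp only [ha', hcid x hx, max_eq_left (hv x hx)]
    have h2 : 0 ≤ a x (v x) * |d x| := mul_nonneg (ha0 x _ hx (hv x hx)) (abs_nonneg _)
    simp only [h1, hF', max_eq_left (hv x hx), max_eq_left h2]
  obtain ⟨φ, hmaps, hlip, hW, hI⟩ := exists_lipschitz_tendsto_energy hF'c
    (fun v p => hF0 _ _ (le_max_right _ _) (le_max_right _ _))
    (fun v => (hFconv _ (le_max_right _ _)).congr (hF'p v))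
    (fun v => (hFmono _ (le_max_right _ _)).congr (hF'p v)) ha'c
    (fun x v => ha0 _ _ (hcmem x) (le_max_right _ _)) hmono' hgm hgi hUsub
  have hU0 : ∀ x ∈ Icc (-1 : ℝ) 1, 0 ≤ U x := fun x hx => by rw [hUu x hx]; exact hnn x hx
  have hUk0 : ∀ k, ∀ x ∈ Icc (-1 : ℝ) 1, 0 ≤ (U ∘ φ k) x := fun k x hx => hU0 _ (hmaps k hx)
  refine ⟨fun k => U ∘ φ k, fun k => ?_, hUk0, ?_, ?_⟩
  · obtain ⟨K, hK⟩ := hlip k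
    exact ⟨K, hK.lipschitzOnWith⟩
  · refine hW.congr fun k => setIntegral_congr_fun measurableSet_Icc fun x hx => ?_
    simp only [hUu x hx, hgid x hx]
  · have hlimit : energy F' a' U g = Ifun F a u := by
      rw [hE U g hU0]
      refine setLIntegral_congr_fun measurableSet_Icc fun x hx => ?_
      simp only [hUu x hx, hgid x hx]
    rw [← hlimit]
    exact hI.congr fun k => hE _ _ (hUk0 k)
end
end
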